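/- arXiv:2210.12665 — 2 statements merged into one kernel-verified Lean document; each statement's English description precedes it below -/
import Mathlib

section
/- Let P be a closed path polyomino and K a field. Suppose that P contains, up to reflections or rotations and up to relabelling of the cells, a skew configuration of four consecutive cells, i.e., four consecutive cells of the closed path whose lower-left corners are (after a rotation or reflection) (0,0), (1,0), (1,1), (2,1), so that the path changes direction at both middle cells. Then the polyomino ideal I_P is of König type. -/
open scoped MonomialOrder

/-- A cell of `ℤ²`, identified with its lower-left corner. -/
abbrev Cell : Type := ℤ × ℤ

/-- The four vertices of a cell. -/
def cellVerts (c : Cell) : Finset Cell :=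
  {c, (c.1 + 1, c.2), (c.1, c.2 + 1), (c.1 + 1, c.2 + 1)}

/-- Two cells are edge-adjacent if their lower-left corners differ by `(±1,0)` or `(0,±1)`. -/
def EdgeAdj (c d : Cell) : Prop :=
  (c.1 = d.1 ∧ (c.2 = d.2 + 1 ∨ d.2 = c.2 + 1)) ∨
  (c.2 = d.2 ∧ (c.1 = d.1 + 1 ∨ d.1 = c.1 + 1))

/-- `L` is a path of cells from `C` to `D`, all cells lying in `S`:
consecutive cells are edge-adjacent and all cells are distinct. -/
def IsCellPath (S : Set Cell) (C D : Cell) (L : List Cell) : Prop :=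
  L.head? = some C ∧ L.getLast? = some D ∧
  L.Chain' EdgeAdj ∧ L.Nodup ∧ ∀ c ∈ L, c ∈ S

/-- A polyomino: a finite nonempty collection of cells, any two of which are
connected by a path of cells of the collection. -/
def IsPolyomino (P : Finset Cell) : Prop :=
  P.Nonempty ∧ ∀ C ∈ P, ∀ D ∈ P, ∃ L, IsCellPath (↑P) C D L

/-- The vertex set `V(P)` of a collection of cells. -/
def polyVerts (P : Finset Cell) : Finset Cell := P.biUnion cellVerts

/-- `A : ZMod n → Cell` realizes `P` as a closed path of cells:
consecutive cells (cyclically) share an edge, all cells are distinct, cells that are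
not cyclically within distance 2 share no vertex, and `P` is the set of cells of the sequence. -/
def IsClosedPathSeq (n : ℕ) (A : ZMod n → Cell) (P : Finset Cell) : Prop :=
  (∀ i, EdgeAdj (A i) (A (i + 1))) ∧
  Function.Injective A ∧
  (∀ i j : ZMod n, j ∉ ({i - 2, i - 1, i, i + 1, i + 2} : Set (ZMod n)) →
    cellVerts (A i) ∩ cellVerts (A j) = ∅) ∧
  (P : Set Cell) = Set.range A

/-- A closed path polyomino. -/
def IsClosedPath (P : Finset Cell) : Prop :=
  ∃ n : ℕ, 5 < n ∧ ∃ A : ZMod n → Cell, IsClosedPathSeq n A P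
/-- `[a,b]` is an inner interval of `P`: it is a proper interval of `ℤ²` and every cell
of `ℤ²` contained in it belongs to `P`. -/
def IsInnerInterval (P : Finset Cell) (a b : Cell) : Prop :=
  a.1 < b.1 ∧ a.2 < b.2 ∧
  ∀ c : Cell, a.1 ≤ c.1 → c.1 + 1 ≤ b.1 → a.2 ≤ c.2 → c.2 + 1 ≤ b.2 → c ∈ P

/-- The inner 2-minors of `P` : for each inner interval `[a,b]` of `P` with diagonal
corners `a, b` and anti-diagonal corners `c, d`, the binomial `x_a x_b - x_c x_d`. -/
def innerMinors (K : Type*) [Field K] (P : Finset Cell) :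
    Set (MvPolynomial {v // v ∈ polyVerts P} K) :=
  { f | ∃ a b c d : {v // v ∈ polyVerts P},
      IsInnerInterval P (a : Cell) (b : Cell) ∧
      (c : Cell) = ((a : Cell).1, (b : Cell).2) ∧
      (d : Cell) = ((b : Cell).1, (a : Cell).2) ∧
      f = MvPolynomial.X a * MvPolynomial.X b - MvPolynomial.X c * MvPolynomial.X d }

/-- The polyomino ideal `I_P ⊆ S_P = K[x_v : v ∈ V(P)]`, generated by the
inner 2-minors of `P`. -/
noncomputable def polyIdeal (K : Type*) [Field K] (P : Finset Cell) :
    Ideal (MvPolynomial {v // v ∈ polyVerts P} K) :=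
  Ideal.span (innerMinors K P)

/-- The height of an ideal: the infimum of the heights of the prime ideals containing it. -/
noncomputable def idealHeight {R : Type*} [CommRing R] (I : Ideal R) : ℕ∞ :=
  ⨅ (p : PrimeSpectrum R) (_ : I ≤ p.asIdeal), Order.height p

universe u₁ u₂ u₃

/-- `g` is the initial term of `f` with respect to the monomial order `m`. -/
def IsInitialTerm {σ : Type u₁} {K : Type u₂} [Field K] (m : MonomialOrder.{u₁, u₃} σ)
    (f g : MvPolynomial σ K) : Prop :=
  ∃ d ∈ f.support, (∀ e ∈ f.support, e ≼[m] d) ∧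
    g = MvPolynomial.monomial d (MvPolynomial.coeff d f)

/-- A graded ideal `I` of a polynomial ring is of König type if, with `h` the height of
`I`, there are homogeneous polynomials `f 0, …, f (h-1)` forming part of a minimal system
of homogeneous generators of `I` and a monomial order such that the corresponding initial
terms form a regular sequence. -/
def IsKoenigType {σ : Type u₁} {K : Type u₂} [Field K] (I : Ideal (MvPolynomial σ K)) : Prop :=
  ∃ h : ℕ, idealHeight I = (h : ℕ∞) ∧
    ∃ (f : Fin h → MvPolynomial σ K) (G : Set (MvPolynomial σ K)),
      Function.Injective f ∧ (∀ i, f i ∈ G) ∧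
      (∀ g ∈ G, ∃ n, MvPolynomial.IsHomogeneous g n) ∧
      Ideal.span G = I ∧ (∀ g ∈ G, Ideal.span (G \ {g}) ≠ I) ∧
      ∃ (m : MonomialOrder.{u₁, u₁} σ) (ini : Fin h → MvPolynomial σ K),
        (∀ i, IsInitialTerm m (f i) (ini i)) ∧
        RingTheory.Sequence.IsRegular (MvPolynomial σ K) (List.ofFn ini)
/-- A unit vector of `ℤ²`. -/
def UnitVec (d : Cell) : Prop :=
  d = (1, 0) ∨ d = (-1, 0) ∨ d = (0, 1) ∨ d = (0, -1)

/-- Two vectors of `ℤ²` are orthogonal. -/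
def Orth (d e : Cell) : Prop := d.1 * e.1 + d.2 * e.2 = 0

/-- The closed path sequence `A` contains a skew configuration of four consecutive cells:
four consecutive cells whose lower-left corners are, after a rotation or reflection (and a
translation), `(0,0)`, `(1,0)`, `(1,1)`, `(2,1)`; equivalently, the successive differences of
their lower-left corners are `d, e, d` for two orthogonal unit vectors `d, e`. -/
def HasSkewConfig {n : ℕ} (A : ZMod n → Cell) : Prop :=
  ∃ (i : ZMod n) (d e : Cell), UnitVec d ∧ UnitVec e ∧ Orth d e ∧
    A (i + 1) = A i + d ∧ A (i + 2) = A (i + 1) + e ∧ A (i + 3) = A (i + 2) + d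

/-- The (cyclic) path `A` has a change of direction at `k` : the lower-left corners of the
preceding and following cells differ in both coordinates. -/
def ChangesDirAt {n : ℕ} (A : ZMod n → Cell) (k : ZMod n) : Prop :=
  (A (k - 1)).1 ≠ (A (k + 1)).1 ∧ (A (k - 1)).2 ≠ (A (k + 1)).2

/-- `C 0, …, C 4` is an L-configuration: a path of five cells where `C 0, C 1, C 2` and
`C 2, C 3, C 4` go in two orthogonal directions. -/
def IsLConfig (C : Fin 5 → Cell) : Prop :=
  ∃ d e : Cell, UnitVec d ∧ UnitVec e ∧ Orth d e ∧
    C 1 = C 0 + d ∧ C 2 = C 1 + d ∧ C 3 = C 2 + e ∧ C 4 = C 3 + e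

/-- The closed path `A` with cell set `P` has an L-configuration in every change of
direction: every cell at which the path changes direction belongs to a path of five cells
of `P` forming an L-configuration. -/
def HasLConfigAtEveryChangeOfDir {n : ℕ} (A : ZMod n → Cell) (P : Finset Cell) : Prop :=
  ∀ k : ZMod n, ChangesDirAt A k →
    ∃ C : Fin 5 → Cell, IsLConfig C ∧ (∀ i, C i ∈ P) ∧ ∃ i, C i = A k

section GB
open MvPolynomial

variable {σ : Type*} {K : Type*} [Field K] (m : MonomialOrder σ)

lemma pk_isUnit {f : MvPolynomial σ K} (hf : f ≠ 0) : IsUnit (m.leadingCoeff f) := by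
  rw [isUnit_iff_ne_zero]
  exact m.leadingCoeff_ne_zero_iff.mpr hf

lemma pk_reduce {f g : MvPolynomial σ K} (hf : f ≠ 0) (hf0 : m.degree f ≠ 0)
    (h : m.degree f ≤ m.degree g) :
    ∃ t : MvPolynomial σ K, m.degree (g - t * f) ≺[m] m.degree g := by
  have hg0 : m.degree g ≠ 0 := by
    intro h0
    rw [h0] at h
    exact hf0 (le_antisymm h (by simp))
  exact ⟨_, m.degree_reduce_lt (pk_isUnit m hf) h hg0⟩

lemma pk_coprime_le {a b c : σ →₀ ℕ} (h : Disjoint a.support b.support) (hle : a ≤ c + b) :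
    a ≤ c := by
  intro x
  have := hle x
  by_cases hx : a x = 0
  · simp [hx]
  · have hb : b x = 0 := by
      by_contra hb
      exact Finset.disjoint_left.mp h (Finsupp.mem_support_iff.mpr hx)
        (Finsupp.mem_support_iff.mpr hb)
    simpa [hb] using this

noncomputable def pkJ (f : ℕ → MvPolynomial σ K) (k : ℕ) : Ideal (MvPolynomial σ K) :=
  Ideal.span (f '' {i | i < k})

lemma pk_mem (f : ℕ → MvPolynomial σ K) {i k : ℕ} (h : i < k) : f i ∈ pkJ f k :=
  Ideal.subset_span ⟨i, h, rfl⟩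

lemma pkJ_succ (f : ℕ → MvPolynomial σ K) (k : ℕ) :
    pkJ f (k + 1) = pkJ f k ⊔ Ideal.span {f k} := by
  unfold pkJ
  rw [← Ideal.span_union]
  congr 1
  ext x
  simp only [Set.mem_image, Set.mem_ofPred_eq, Set.mem_union, Set.mem_singleton_iff]
  constructor
  · rintro ⟨i, hi, rfl⟩
    rcases Nat.lt_succ_iff_lt_or_eq.mp hi with h | rfl
    · exact Or.inl ⟨i, h, rfl⟩
    · exact Or.inr rfl
  · rintro (⟨i, hi, rfl⟩ | rfl)
    · exact ⟨i, by omega, rfl⟩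
    · exact ⟨k, by omega, rfl⟩

lemma pk_gb (f : ℕ → MvPolynomial σ K) (N : ℕ) (hne : ∀ i < N, f i ≠ 0)
    (hd : ∀ i < N, m.degree (f i) ≠ 0)
    (hc : ∀ i < N, ∀ j < N, i < j → Disjoint (m.degree (f i)).support (m.degree (f j)).support) :
    ∀ k ≤ N, ∀ h ∈ pkJ f k, h ≠ 0 → ∃ i < k, m.degree (f i) ≤ m.degree h := by
  intro k
  induction k with
  | zero =>
    intro _ h hh h0
    exfalso
    apply h0
    simpa [pkJ] using hh
  | succ k ih =>
    intro hk h hh h0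
    rw [pkJ_succ, Submodule.mem_sup] at hh
    obtain ⟨y, hy, z, hz, hyz⟩ := hh
    obtain ⟨g, rfl⟩ := Ideal.mem_span_singleton'.mp hz
    clear hz
    have key : ∀ s : m.syn, ∀ g y : MvPolynomial σ K, m.toSyn (m.degree g) = s → y ∈ pkJ f k →
        y + g * f k = h → ∃ i < k + 1, m.degree (f i) ≤ m.degree h := by
      intro s
      induction s using WellFoundedLT.induction with
      | ind s IH =>
        intro g y hs hy hyz
        by_cases hg : g = 0
        · subst hg
          simp only [zero_mul, add_zero] at hyz
          subst hyz
          obtain ⟨i, hi, hle⟩ := ih (by omega) y hy h0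
          exact ⟨i, by omega, hle⟩
        by_cases hex : ∃ i < k, m.degree (f i) ≤ m.degree g
        · obtain ⟨i, hi, hle⟩ := hex
          obtain ⟨t, ht⟩ := pk_reduce m (hne i (by omega)) (hd i (by omega)) hle
          refine IH _ (hs ▸ ht) (g - t * f i) (y + t * f k * f i) rfl ?_ ?_
          · exact Ideal.add_mem _ hy (Ideal.mul_mem_left _ _ (pk_mem f hi))
          · rw [← hyz]; ring
        · push Not at hex
          have hdeg : m.degree (g * f k) = m.degree g + m.degree (f k) :=
            m.degree_mul hg (hne k (by omega))
          have hgf : g * f k ≠ 0 := mul_ne_zero hg (hne k (by omega))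
          by_cases hy0 : y = 0
          · subst hy0
            refine ⟨k, by omega, ?_⟩
            rw [← hyz, zero_add, hdeg]
            exact le_add_self
          obtain ⟨i, hi, hle⟩ := ih (by omega) y hy hy0
          have hneq : m.degree y ≠ m.degree (g * f k) := by
            intro heq
            rw [heq, hdeg] at hle
            exact hex i hi (pk_coprime_le (hc i (by omega) k (by omega) hi) hle)
          rcases lt_or_gt_of_ne (fun h' => hneq (m.toSyn.injective h')) with hlt | hlt
          · refine ⟨k, by omega, ?_⟩
            rw [← hyz, m.degree_add_eq_right_of_lt hlt, hdeg]
            exact le_add_self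
          · refine ⟨i, by omega, ?_⟩
            rw [← hyz, m.degree_add_of_lt hlt]
            exact hle
    exact key _ g y rfl hy hyz

lemma pk_reg (f : ℕ → MvPolynomial σ K) (N : ℕ) (hne : ∀ i < N, f i ≠ 0)
    (hd : ∀ i < N, m.degree (f i) ≠ 0)
    (hc : ∀ i < N, ∀ j < N, i < j → Disjoint (m.degree (f i)).support (m.degree (f j)).support)
    (k : ℕ) (hk : k < N) (g : MvPolynomial σ K) (hg : f k * g ∈ pkJ f k) : g ∈ pkJ f k := by
  have key : ∀ s : m.syn, ∀ g : MvPolynomial σ K, m.toSyn (m.degree g) = s →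
      f k * g ∈ pkJ f k → g ∈ pkJ f k := by
    intro s
    induction s using WellFoundedLT.induction with
    | ind s IH =>
      intro g hs hg
      by_cases hg0 : g = 0
      · subst hg0; exact Ideal.zero_mem _
      obtain ⟨i, hi, hle⟩ := pk_gb m f N hne hd hc k hk.le _ hg (mul_ne_zero (hne k hk) hg0)
      rw [m.degree_mul (hne k hk) hg0, add_comm] at hle
      have hle' := pk_coprime_le (hc i (by omega) k hk hi) hle
      obtain ⟨t, ht⟩ := pk_reduce m (hne i (by omega)) (hd i (by omega)) hle'
      have h1 := IH _ (hs ▸ ht) (g - t * f i) rfl (by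
        rw [mul_sub]
        refine Ideal.sub_mem _ hg ?_
        rw [← mul_assoc]
        exact Ideal.mul_mem_left _ _ (pk_mem f hi))
      have h2 := Ideal.add_mem _ h1 (Ideal.mul_mem_left _ t (pk_mem f hi))
      simpa using h2
  exact key _ g rfl hg

lemma pk_height {R : Type*} [CommRing R] (f : ℕ → R) (N : ℕ)
    (hreg : ∀ k < N, ∀ g, f k * g ∈ Ideal.span (f '' {i | i < k}) →
      g ∈ Ideal.span (f '' {i | i < k})) :
    ∀ k ≤ N, ∀ p : Ideal R, p.IsPrime → Ideal.span (f '' {i | i < k}) ≤ p →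
      (k : ℕ∞) ≤ p.height := by
  intro k
  induction k with
  | zero => intro _ p _ _; simp
  | succ k ih =>
    intro hk p hp hle
    have hle' : Ideal.span (f '' {i | i < k}) ≤ p :=
      le_trans (Ideal.span_mono (Set.image_mono (fun i (hi : i < k) => (by
        show i < k + 1
        omega)))) hle
    obtain ⟨q, hq, hqp⟩ := Ideal.exists_minimalPrimes_le hle'
    have hqP : q.IsPrime := hq.isPrime
    have h1 := ih (by omega) q hqP hq.le
    have hfk : f k ∉ q := by
      intro hmem
      obtain ⟨y, hy, hxy⟩ := Ideal.exists_mul_mem_of_mem_minimalPrimes hq hmem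
      exact hy (hreg k (by omega) y hxy)
    have hlt : q < p := lt_of_le_of_ne hqp (by
      rintro rfl
      exact hfk (hle (Ideal.subset_span ⟨k, by simp, rfl⟩)))
    have h2 := Ideal.height_add_one_le_of_lt_of_isPrime hlt
    push_cast
    exact le_trans (by gcongr) h2

lemma pk_isRegular (f : ℕ → MvPolynomial σ K) (N : ℕ) (hne : ∀ i < N, f i ≠ 0)
    (hd : ∀ i < N, m.degree (f i) ≠ 0)
    (hc : ∀ i < N, ∀ j < N, i < j → Disjoint (m.degree (f i)).support (m.degree (f j)).support)
    (h0 : ∀ i < N, MvPolynomial.constantCoeff (f i) = 0) :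
    RingTheory.Sequence.IsRegular (MvPolynomial σ K) (List.ofFn (fun i : Fin N => f i)) := by
  have hof : ∀ k ≤ N, Ideal.ofList ((List.ofFn (fun i : Fin N => f i)).take k) = pkJ f k := by
    intro k hk
    unfold Ideal.ofList pkJ
    congr 1
    ext x
    simp only [Set.mem_ofPred_eq, Set.mem_image, List.mem_take_iff_getElem, List.length_ofFn,
      List.getElem_ofFn, lt_min_iff]
    constructor
    · rintro ⟨i, hi, rfl⟩
      exact ⟨i, hi.1, rfl⟩
    · rintro ⟨i, hi, rfl⟩
      exact ⟨i, ⟨hi, by omega⟩, rfl⟩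
  refine ⟨⟨?_⟩, ?_⟩
  · intro k hk
    rw [List.length_ofFn] at hk
    rw [hof k hk.le, isSMulRegular_quotient_iff_mem_of_smul_mem]
    intro g hg
    simp only [List.getElem_ofFn, smul_eq_mul, Ideal.mul_top] at hg ⊢
    exact pk_reg m f N hne hd hc k hk g hg
  · have := hof N le_rfl
    rw [List.take_of_length_le (by simp)] at this
    rw [this, smul_eq_mul, Ideal.mul_top]
    intro htop
    have hle : pkJ f N ≤ RingHom.ker (MvPolynomial.constantCoeff (R := K) (σ := σ)) := by
      unfold pkJ
      rw [Ideal.span_le]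
      rintro _ ⟨i, hi, rfl⟩
      exact h0 i hi
    rw [← htop] at hle
    have h1 := hle (Submodule.mem_top (x := (1 : MvPolynomial σ K)))
    simp [RingHom.mem_ker] at h1

lemma pk_order {σ : Type u₁} [Finite σ] {α : Type*} [LinearOrder α] (κ : σ → α) (hκ : Function.Injective κ) :
    ∃ m : MonomialOrder.{u₁, u₁} σ, ∀ p q r s : σ, r ≠ p → s ≠ p → κ p < κ r → κ p < κ s →
      (Finsupp.single r 1 + Finsupp.single s 1 : σ →₀ ℕ) ≺[m]
        (Finsupp.single p 1 + Finsupp.single q 1) := by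
  let _ : LinearOrder σ := LinearOrder.lift' κ hκ
  refine ⟨MonomialOrder.lex, ?_⟩
  intro p q r s hr hs h1 h2
  rw [MonomialOrder.lex_lt_iff]
  have h1' : p < r := h1
  have h2' : p < s := h2
  by_cases hq : q < p
  · refine Finsupp.Lex.lt_iff.mpr ⟨q, fun j hj => ?_, ?_⟩
    · simp [Finsupp.single_apply, (hj.trans hq).ne', hj.ne', (hj.trans (hq.trans h1')).ne',
        (hj.trans (hq.trans h2')).ne']
    · simp [Finsupp.single_apply, (hq.trans h1').ne', (hq.trans h2').ne']
  · refine Finsupp.Lex.lt_iff.mpr ⟨p, fun j hj => ?_, ?_⟩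
    · have : q ≠ j := fun h => hq (h ▸ hj)
      simp [Finsupp.single_apply, hj.ne', (hj.trans h1').ne', (hj.trans h2').ne', this]
    · simp [Finsupp.single_apply, hr, hs]
end GB

section Cert
open MvPolynomial

def PkRect (P : Finset Cell) (p q r s : Cell) : Prop :=
  p.1 ≠ q.1 ∧ p.2 ≠ q.2 ∧
  ((r = (p.1, q.2) ∧ s = (q.1, p.2)) ∨ (r = (q.1, p.2) ∧ s = (p.1, q.2))) ∧
  ∀ c : Cell, min p.1 q.1 ≤ c.1 → c.1 + 1 ≤ max p.1 q.1 →
    min p.2 q.2 ≤ c.2 → c.2 + 1 ≤ max p.2 q.2 → c ∈ P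

lemma pk_vert {P : Finset Cell} {c v : Cell} (hc : c ∈ P) (h1 : v.1 = c.1 ∨ v.1 = c.1 + 1)
    (h2 : v.2 = c.2 ∨ v.2 = c.2 + 1) : v ∈ polyVerts P := by
  unfold polyVerts
  rw [Finset.mem_biUnion]
  refine ⟨c, hc, ?_⟩
  obtain ⟨x, y⟩ := v
  obtain ⟨z, w⟩ := c
  simp only [cellVerts, Finset.mem_insert, Finset.mem_singleton, Prod.mk.injEq] at *
  omega

lemma pk_inner_verts {P : Finset Cell} {a b : Cell} (h : IsInnerInterval P a b) :
    a ∈ polyVerts P ∧ b ∈ polyVerts P ∧ ((a.1, b.2) : Cell) ∈ polyVerts P ∧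
      ((b.1, a.2) : Cell) ∈ polyVerts P := by
  obtain ⟨h1, h2, h3⟩ := h
  refine ⟨?_, ?_, ?_, ?_⟩
  · exact pk_vert (c := (a.1, a.2)) (h3 _ (by simp) (by simp; omega) (by simp) (by simp; omega))
      (by simp) (by simp)
  · exact pk_vert (c := (b.1 - 1, b.2 - 1)) (h3 _ (by simp; omega) (by simp) (by simp; omega)
      (by simp)) (by simp) (by simp)
  · exact pk_vert (c := (a.1, b.2 - 1)) (h3 _ (by simp) (by simp; omega) (by simp; omega)
      (by simp)) (by simp) (by simp)
  · exact pk_vert (c := (b.1 - 1, a.2)) (h3 _ (by simp; omega) (by simp) (by simp)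
      (by simp; omega)) (by simp) (by simp)

variable (K : Type*) [Field K]

lemma pk_inner_minor {P : Finset Cell} {a b c d : Cell} (h : IsInnerInterval P a b)
    (hc : c = (a.1, b.2)) (hd : d = (b.1, a.2)) (ha' : a ∈ polyVerts P) (hb' : b ∈ polyVerts P)
    (hc' : c ∈ polyVerts P) (hd' : d ∈ polyVerts P) :
    (X ⟨a, ha'⟩ * X ⟨b, hb'⟩ - X ⟨c, hc'⟩ * X ⟨d, hd'⟩ : MvPolynomial {v // v ∈ polyVerts P} K) ∈
      innerMinors K P :=
  ⟨⟨a, ha'⟩, ⟨b, hb'⟩, ⟨c, hc'⟩, ⟨d, hd'⟩, h, hc, hd, rfl⟩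

lemma pk_rect_minor {P : Finset Cell} {p q r s : Cell} (h : PkRect P p q r s) :
    ∃ p' q' r' s' : {v // v ∈ polyVerts P}, p'.1 = p ∧ q'.1 = q ∧ r'.1 = r ∧ s'.1 = s ∧
      ∃ ε : K, ε ≠ 0 ∧ C ε * (X p' * X q' - X r' * X s') ∈ innerMinors K P := by
  obtain ⟨h1, h2, h3, h4⟩ := h
  wlog hrs : r = (p.1, q.2) ∧ s = (q.1, p.2) generalizing r s
  · obtain ⟨p', q', r', s', e1, e2, e3, e4, ε, h5, h6⟩ := this (r := s) (s := r)
      (by tauto) (by tauto)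
    exact ⟨p', q', s', r', e1, e2, e4, e3, ε, h5, by rwa [mul_comm (X s')]⟩
  obtain ⟨rfl, rfl⟩ := hrs
  clear h3
  wlog hlt : p.1 < q.1 generalizing p q
  · obtain ⟨p', q', r', s', e1, e2, e3, e4, ε, h5, h6⟩ := this (p := q) (q := p)
      h1.symm h2.symm (by simpa only [min_comm q.1, max_comm q.1, min_comm q.2, max_comm q.2])
        (by omega)
    exact ⟨q', p', s', r', e2, e1, e4, e3, ε, h5, by
      rwa [mul_comm (X s'), mul_comm (X q')]⟩
  by_cases hlt2 : p.2 < q.2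
  · have hI : IsInnerInterval P p q := ⟨hlt, hlt2, fun c a1 a2 a3 a4 =>
      h4 c (by omega) (by omega) (by omega) (by omega)⟩
    obtain ⟨m1, m2, m3, m4⟩ := pk_inner_verts hI
    refine ⟨⟨_, m1⟩, ⟨_, m2⟩, ⟨_, m3⟩, ⟨_, m4⟩, rfl, rfl, rfl, rfl, 1, one_ne_zero, ?_⟩
    rw [C_1, one_mul]
    exact pk_inner_minor K hI rfl rfl _ _ _ _
  · have hI : IsInnerInterval P (p.1, q.2) (q.1, p.2) := ⟨hlt, by simp; omega,
      fun c a1 a2 a3 a4 => h4 c (by simp at *; omega) (by simp at *; omega)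
        (by simp at *; omega) (by simp at *; omega)⟩
    obtain ⟨m1, m2, m3, m4⟩ := pk_inner_verts hI
    refine ⟨⟨_, m3⟩, ⟨_, m4⟩, ⟨_, m1⟩, ⟨_, m2⟩, rfl, rfl, rfl, rfl, -1, by simp, ?_⟩
    have := pk_inner_minor K hI rfl rfl m1 m2 m3 m4
    simpa using this

lemma pk_minimal (P : Finset Cell) (g : MvPolynomial {v // v ∈ polyVerts P} K)
    (hg : g ∈ innerMinors K P) :
    Ideal.span (innerMinors K P \ {g}) ≠ polyIdeal K P := by
  classical
  intro heq
  have hmem : g ∈ Ideal.span (innerMinors K P \ {g}) := by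
    rw [heq]; exact Ideal.subset_span hg
  obtain ⟨a, b, c, d, hI, hc, hd, hgeq⟩ := hg
  set d0 : {v // v ∈ polyVerts P} →₀ ℕ := Finsupp.single a 1 + Finsupp.single b 1 with hd0
  have hle2 : ∀ u v : {v // v ∈ polyVerts P}, u ≠ v →
      (Finsupp.single u 1 + Finsupp.single v 1 : _ →₀ ℕ) ≤ d0 →
      (u = a ∧ v = b) ∨ (u = b ∧ v = a) := by
    intro u v huv hle
    have h1 := hle u
    have h2 := hle v
    simp only [hd0, Finsupp.coe_add, Pi.add_apply, Finsupp.single_apply] at h1 h2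
    by_cases e1 : a = u <;> by_cases e2 : b = u <;> by_cases e3 : a = v <;> by_cases e4 : b = v <;>
      simp_all
  have hXX : ∀ u v : {v // v ∈ polyVerts P}, (X u * X v : MvPolynomial _ K) =
      monomial (Finsupp.single u 1 + Finsupp.single v 1) 1 := by
    intro u v; simp [X, monomial_mul]
  have hlt := hI.1
  have hlt2 := hI.2.1
  have hcd : ¬ (Finsupp.single c 1 + Finsupp.single d 1 : _ →₀ ℕ) ≤ d0 := by
    intro hle
    have hne : c ≠ d := by
      rintro rfl
      rw [hc] at hd
      simp at hd; omega
    rcases hle2 c d hne hle with ⟨h1, h2⟩ | ⟨h1, h2⟩ <;> subst h1 <;> subst h2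
    · rw [Prod.ext_iff] at hc; simp at hc; omega
    · rw [Prod.ext_iff] at hc; simp at hc; omega
  have key : ∀ h ∈ Ideal.span (innerMinors K P \ {g}), ∀ e ≤ d0, coeff e h = 0 := by
    intro h hh
    induction hh using Submodule.span_induction with
    | mem x hx =>
      obtain ⟨⟨a', b', c', d', hI', hc', hd', rfl⟩, hne⟩ := hx
      intro e he
      have hlt' := hI'.1
      have hlt2' := hI'.2.1
      rw [hXX, hXX, coeff_sub, coeff_monomial, coeff_monomial, if_neg, if_neg, sub_zero]
      · rintro rfl
        have hn : c' ≠ d' := by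
          rintro rfl
          rw [hc'] at hd'
          simp at hd'; omega
        rcases hle2 c' d' hn he with ⟨h1, h2⟩ | ⟨h1, h2⟩ <;> subst h1 <;> subst h2 <;>
          rw [Prod.ext_iff] at hc' hd' <;> simp at hc' hd' <;> omega
      · rintro rfl
        have hn : a' ≠ b' := by
          rintro rfl
          omega
        rcases hle2 a' b' hn he with ⟨h1, h2⟩ | ⟨h1, h2⟩
        · subst h1; subst h2
          have e1 : c' = c := Subtype.ext (hc'.trans hc.symm)
          have e2 : d' = d := Subtype.ext (hd'.trans hd.symm)
          subst e1; subst e2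
          exact hne hgeq.symm
        · subst h1; subst h2
          omega
    | zero => intro e _; simp
    | add x y _ _ hx hy => intro e he; rw [coeff_add, hx e he, hy e he, add_zero]
    | smul t x _ hx =>
      intro e he
      rw [smul_eq_mul, coeff_mul]
      apply Finset.sum_eq_zero
      intro u hu
      rw [Finset.HasAntidiagonal.mem_antidiagonal] at hu
      rw [hx u.2 (le_trans (by rw [← hu]; exact le_add_self) he), mul_zero]
  have h0 := key g hmem d0 le_rfl
  rw [hgeq, hXX, hXX, coeff_sub, coeff_monomial, coeff_monomial, if_pos rfl, if_neg] at h0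
  · simp at h0
  · intro h; exact hcd h.le

lemma pk_telescope {R : Type*} [CommRing R] [IsDomain R] (P : Finset Cell) (y : Cell → R)
    (hy : ∀ v, y v ≠ 0)
    (hcell : ∀ c ∈ P, y c * y (c.1 + 1, c.2 + 1) = y (c.1, c.2 + 1) * y (c.1 + 1, c.2))
    (w h : ℕ) : ∀ a : Cell,
      (∀ i < w, ∀ j < h, ((a.1 + (i : ℤ), a.2 + (j : ℤ)) : Cell) ∈ P) →
      y a * y (a.1 + w, a.2 + h) = y (a.1, a.2 + h) * y (a.1 + w, a.2) := by
  have h1 : ∀ (h : ℕ) (a : Cell), (∀ j < h, ((a.1, a.2 + (j : ℤ)) : Cell) ∈ P) →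
      y a * y (a.1 + 1, a.2 + h) = y (a.1, a.2 + h) * y (a.1 + 1, a.2) := by
    intro h
    induction h with
    | zero => intro a _; simp
    | succ h ih =>
      intro a ha
      have e1 := ih a (fun j hj => ha j (by omega))
      have e2 := hcell _ (ha h (by omega))
      simp only at e2
      have n1 := hy (a.1, a.2 + h)
      have n2 := hy (a.1 + 1, a.2 + h)
      apply mul_left_cancel₀ (mul_ne_zero n1 n2)
      push_cast
      rw [← add_assoc]
      linear_combination (y (a.1, a.2 + h) * y (a.1 + 1, a.2 + h + 1)) * e1 +
        (y (a.1, a.2 + h) * y (a.1 + 1, a.2)) * e2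
  induction w with
  | zero => intro a _; simp [mul_comm]
  | succ w ih =>
    intro a ha
    have e1 := ih a (fun i hi j hj => ha i (by omega) j hj)
    have e2 := h1 h (a.1 + w, a.2) (fun j hj => ha w (by omega) j hj)
    simp only at e2
    have n1 := hy (a.1 + w, a.2)
    have n2 := hy (a.1 + w, a.2 + h)
    apply mul_left_cancel₀ (mul_ne_zero n1 n2)
    push_cast
    rw [← add_assoc]
    linear_combination (y (a.1 + w, a.2) * y (a.1 + w + 1, a.2 + h)) * e1 +
        (y (a.1, a.2 + h) * y (a.1 + w, a.2)) * e2

lemma pk_height_le (P : Finset Cell) : idealHeight (polyIdeal K P) ≤ (P.card : ℕ∞) := by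
  classical
  have hin : ∀ c ∈ P, IsInnerInterval P c (c.1 + 1, c.2 + 1) := by
    intro c hc
    refine ⟨by simp, by simp, ?_⟩
    intro c' h1 h2 h3 h4
    have : c' = c := Prod.ext (by simp at *; omega) (by simp at *; omega)
    exact this ▸ hc
  let cm : {c // c ∈ P} → MvPolynomial {v // v ∈ polyVerts P} K := fun c =>
    X ⟨c.1, (pk_inner_verts (hin c.1 c.2)).1⟩ * X ⟨_, (pk_inner_verts (hin c.1 c.2)).2.1⟩ -
    X ⟨_, (pk_inner_verts (hin c.1 c.2)).2.2.1⟩ * X ⟨_, (pk_inner_verts (hin c.1 c.2)).2.2.2⟩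
  let s : Finset (MvPolynomial {v // v ∈ polyVerts P} K) := P.attach.image cm
  have hs : s.card ≤ P.card := le_trans Finset.card_image_le (by simp)
  let ev : MvPolynomial {v // v ∈ polyVerts P} K →+* K := eval (fun _ => 1)
  have hle : Ideal.span (s : Set (MvPolynomial {v // v ∈ polyVerts P} K)) ≤ RingHom.ker ev := by
    rw [Ideal.span_le]
    intro x hx
    simp only [s, Finset.coe_image, Set.mem_image] at hx
    obtain ⟨c, -, rfl⟩ := hx
    simp [RingHom.mem_ker, cm, ev]
  have hprime : (RingHom.ker ev).IsPrime := RingHom.ker_isPrime ev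
  obtain ⟨q, hq, hqle⟩ := Ideal.exists_minimalPrimes_le hle
  have hqP : q.IsPrime := hq.isPrime
  have hht : q.height ≤ P.card :=
    le_trans (Ideal.height_le_card_of_mem_minimalPrimes_span_finset hq) (by exact_mod_cast hs)
  have hvar : ∀ v : {v // v ∈ polyVerts P}, (X v : MvPolynomial _ K) ∉ q := by
    intro v hv
    have := hqle hv
    simp [RingHom.mem_ker, ev] at this
  have hIq : polyIdeal K P ≤ q := by
    unfold polyIdeal
    rw [Ideal.span_le]
    rintro _ ⟨a, b, c, d, hI, hc, hd, rfl⟩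
    let y : Cell → (MvPolynomial {v // v ∈ polyVerts P} K ⧸ q) := fun v =>
      if hv : v ∈ polyVerts P then Ideal.Quotient.mk q (X ⟨v, hv⟩) else 1
    have hyv : ∀ (v : Cell) (hv : v ∈ polyVerts P), y v = Ideal.Quotient.mk q (X ⟨v, hv⟩) :=
      fun v hv => dif_pos hv
    have hy0 : ∀ v, y v ≠ 0 := by
      intro v
      by_cases hv : v ∈ polyVerts P
      · rw [hyv v hv, Ne, Ideal.Quotient.eq_zero_iff_mem]
        exact hvar _
      · simp [y, hv]
    have hcell : ∀ c ∈ P, y c * y (c.1 + 1, c.2 + 1) = y (c.1, c.2 + 1) * y (c.1 + 1, c.2) := by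
      intro c hc
      have hv := pk_inner_verts (hin c hc)
      rw [hyv _ hv.1, hyv _ hv.2.1, hyv _ hv.2.2.1, hyv _ hv.2.2.2, ← map_mul, ← map_mul,
        Ideal.Quotient.mk_eq_mk_iff_sub_mem]
      apply hq.le
      apply Ideal.subset_span
      simp only [s, Finset.coe_image, Set.mem_image]
      exact ⟨⟨c, hc⟩, by simp, rfl⟩
    have hlt := hI.1
    have hlt2 := hI.2.1
    have ht := pk_telescope P y hy0 hcell (b.1.1 - a.1.1).toNat (b.1.2 - a.1.2).toNat a.1 (by
      intro i hi j hj
      exact hI.2.2 _ (by simp) (by simp; omega) (by simp) (by simp; omega))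
    have e1 : a.1.1 + ((b.1.1 - a.1.1).toNat : ℤ) = b.1.1 := by omega
    have e2 : a.1.2 + ((b.1.2 - a.1.2).toNat : ℤ) = b.1.2 := by omega
    rw [e1, e2, ← hc, ← hd, hyv _ a.2, hyv _ c.2, hyv _ d.2, hyv (b.1.1, b.1.2) b.2, ← map_mul,
      ← map_mul, Ideal.Quotient.mk_eq_mk_iff_sub_mem] at ht
    exact ht
  have h1 : idealHeight (polyIdeal K P) ≤ Order.height (⟨q, hqP⟩ : PrimeSpectrum _) :=
    iInf₂_le (⟨q, hqP⟩ : PrimeSpectrum _) hIq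
  rw [← PrimeSpectrum.height_eq_orderHeight] at h1
  exact h1.trans hht

lemma pk_degree_binom {σ : Type*} (m : MonomialOrder σ) {p q r s : σ} {ε : K} (hε : ε ≠ 0)
    (h : (Finsupp.single r 1 + Finsupp.single s 1 : σ →₀ ℕ) ≺[m]
        (Finsupp.single p 1 + Finsupp.single q 1)) :
    m.degree (C ε * (X p * X q - X r * X s)) = Finsupp.single p 1 + Finsupp.single q 1 := by
  classical
  have e : (C ε * (X p * X q - X r * X s) : MvPolynomial σ K) =
      monomial (Finsupp.single p 1 + Finsupp.single q 1) ε +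
      monomial (Finsupp.single r 1 + Finsupp.single s 1) (-ε) := by
    have e1 : (X p * X q : MvPolynomial σ K) = monomial (Finsupp.single p 1 + Finsupp.single q 1) 1 := by
      rw [X, X, monomial_mul, one_mul]
    have e2 : (X r * X s : MvPolynomial σ K) = monomial (Finsupp.single r 1 + Finsupp.single s 1) 1 := by
      rw [X, X, monomial_mul, one_mul]
    rw [e1, e2, mul_sub, C_mul_monomial, C_mul_monomial, mul_one, map_neg, sub_eq_add_neg]
  rw [e, m.degree_add_of_lt, m.degree_monomial, if_neg hε]
  rw [m.degree_monomial, m.degree_monomial, if_neg hε, if_neg (by simpa using hε)]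
  exact h

theorem pk_cert (P : Finset Cell) (n : ℕ) (hn : P.card = n) (p q r s : ℕ → Cell)
    (hR : ∀ i < n, PkRect P (p i) (q i) (r i) (s i))
    (hpp : ∀ i < n, ∀ j < n, p i = p j → i = j)
    (hqq : ∀ i < n, ∀ j < n, q i = q j → i = j)
    (hpq : ∀ i < n, ∀ j < n, p i ≠ q j)
    (ρ : Cell → ℤ)
    (hρ : ∀ i < n, (ρ (r i) < ρ (p i) ∧ ρ (s i) < ρ (p i)) ∨
      (ρ (r i) < ρ (q i) ∧ ρ (s i) < ρ (q i))) :
    IsKoenigType (polyIdeal K P) := by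
  classical
  let σ := {v // v ∈ polyVerts P}
  obtain ⟨m, hm⟩ := pk_order (σ := σ)
    (fun v : σ => (toLex (- ρ v.1, toLex v.1) : ℤ ×ₗ (ℤ ×ₗ ℤ))) (by
      intro u v huv
      have := congrArg (fun x => ofLex (ofLex x).2) huv
      exact Subtype.ext this)
  have hex : ∀ i : ℕ, ∃ (f : MvPolynomial σ K), i < n → f ∈ innerMinors K P ∧
      ∃ p' q' : σ, p'.1 = p i ∧ q'.1 = q i ∧
        m.degree f = Finsupp.single p' 1 + Finsupp.single q' 1 := by
    intro i
    by_cases hi : i < n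
    swap
    · exact ⟨0, fun h => absurd h hi⟩
    obtain ⟨p', q', r', s', e1, e2, e3, e4, ε, hε, hmem⟩ := pk_rect_minor K (hR i hi)
    refine ⟨_, fun _ => ⟨hmem, p', q', e1, e2, pk_degree_binom K m hε ?_⟩⟩
    have hlt : ∀ u v : σ, ρ v.1 < ρ u.1 →
      (toLex (- ρ u.1, toLex u.1) : ℤ ×ₗ (ℤ ×ₗ ℤ)) < toLex (- ρ v.1, toLex v.1) := by
      intro u v huv
      rw [Prod.Lex.toLex_lt_toLex]
      left
      simpa using huv
    have hne : ∀ u v : σ, ρ v.1 < ρ u.1 → v ≠ u := by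
      rintro u v huv rfl
      exact lt_irrefl _ huv
    have h := hρ i hi
    rw [← e1, ← e2, ← e3, ← e4] at h
    rcases h with ⟨h1, h2⟩ | ⟨h1, h2⟩
    · exact hm p' q' r' s' (hne _ _ h1) (hne _ _ h2) (hlt _ _ h1) (hlt _ _ h2)
    · rw [add_comm (Finsupp.single p' 1)]
      exact hm q' p' r' s' (hne _ _ h1) (hne _ _ h2) (hlt _ _ h1) (hlt _ _ h2)
  choose f hf using hex
  have hd : ∀ i < n, m.degree (f i) ≠ 0 := by
    intro i hi h0
    obtain ⟨-, p', q', -, -, hdeg⟩ := hf i hi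
    rw [hdeg] at h0
    have := DFunLike.congr_fun h0 p'
    simp at this
  have hne : ∀ i < n, f i ≠ 0 := fun i hi => m.ne_zero_of_degree_ne_zero (hd i hi)
  have hc' : ∀ i < n, ∀ j < n, i ≠ j →
      Disjoint (m.degree (f i)).support (m.degree (f j)).support := by
    intro i hi j hj hij
    obtain ⟨-, p1, q1, a1, a2, d1⟩ := hf i hi
    obtain ⟨-, p2, q2, b1, b2, d2⟩ := hf j hj
    rw [Finset.disjoint_left]
    intro v hv1 hv2
    have k1 : v = p1 ∨ v = q1 := by
      by_contra hcon
      push Not at hcon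
      rw [d1, Finsupp.mem_support_iff] at hv1
      apply hv1
      simp [Finsupp.single_apply, hcon.1.symm, hcon.2.symm]
    have k2 : v = p2 ∨ v = q2 := by
      by_contra hcon
      push Not at hcon
      rw [d2, Finsupp.mem_support_iff] at hv2
      apply hv2
      simp [Finsupp.single_apply, hcon.1.symm, hcon.2.symm]
    rcases k1 with rfl | rfl <;> rcases k2 with h | h
    · exact hij (hpp i hi j hj (by rw [← a1, ← b1, h]))
    · exact hpq i hi j hj (by rw [← a1, ← b2, h])
    · exact hpq j hj i hi (by rw [← a2, ← b1, h])
    · exact hij (hqq i hi j hj (by rw [← a2, ← b2, h]))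
  have hc : ∀ i < n, ∀ j < n, i < j →
      Disjoint (m.degree (f i)).support (m.degree (f j)).support :=
    fun i hi j hj hij => hc' i hi j hj hij.ne
  refine ⟨n, le_antisymm (hn ▸ pk_height_le K P) ?_, fun i : Fin n => f i, innerMinors K P,
    ?_, fun i => (hf i i.2).1, ?_, rfl, fun g hg => pk_minimal K P g hg, m,
    fun i : Fin n => m.leadingTerm (f i), ?_, ?_⟩
  · refine le_iInf₂ fun p hp => ?_
    rw [← PrimeSpectrum.height_eq_orderHeight]
    refine pk_height f n (fun k hk g hg => pk_reg m f n hne hd hc k hk g hg) n le_rfl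
      p.asIdeal p.isPrime (le_trans ?_ hp)
    rw [Ideal.span_le]
    rintro _ ⟨i, hi, rfl⟩
    exact Ideal.subset_span (hf i hi).1
  · intro i j hij
    by_contra hne'
    have h1 := hc' i i.2 j j.2 (fun h => hne' (Fin.ext h))
    have hij' : f i = f j := hij
    rw [hij', disjoint_self, Finset.bot_eq_empty, Finsupp.support_eq_empty] at h1
    exact hd j j.2 h1
  · rintro _ ⟨a, b, c, d, -, -, -, rfl⟩
    exact ⟨1 + 1, ((isHomogeneous_X K a).mul (isHomogeneous_X K b)).sub
      ((isHomogeneous_X K c).mul (isHomogeneous_X K d))⟩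
  · intro i
    exact ⟨m.degree (f i), m.degree_mem_support (hne i i.2), fun e he => m.le_degree he, rfl⟩
  · refine pk_isRegular m (fun i => m.leadingTerm (f i)) n ?_ ?_ ?_ ?_
    · intro i hi h
      exact hne i hi ((m.leadingTerm_eq_zero_iff _).mp h)
    · intro i hi
      simpa only [m.degree_leadingTerm] using hd i hi
    · intro i hi j hj hij
      simpa only [m.degree_leadingTerm] using hc i hi j hj hij
    · intro i hi
      rw [MonomialOrder.leadingTerm, constantCoeff_eq, coeff_monomial, if_neg (hd i hi)]

end Cert

section Comb
set_option linter.unusedSimpArgs false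

def PkV (c v : Cell) : Prop := (v.1 = c.1 ∨ v.1 = c.1 + 1) ∧ (v.2 = c.2 ∨ v.2 = c.2 + 1)

lemma pk_V_iff (c v : Cell) : v ∈ cellVerts c ↔ PkV c v := by
  obtain ⟨c1, c2⟩ := c
  obtain ⟨v1, v2⟩ := v
  simp only [cellVerts, PkV, Finset.mem_insert, Finset.mem_singleton, Prod.mk.injEq]
  tauto

lemma pk_W {a b c : Cell} (hab : EdgeAdj a b) (hbc : EdgeAdj b c) (hac : a ≠ c) {v : Cell}
    (h1 : PkV a v) (h2 : PkV c v) : PkV b v := by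
  obtain ⟨a1, a2⟩ := a
  obtain ⟨b1, b2⟩ := b
  obtain ⟨c1, c2⟩ := c
  obtain ⟨v1, v2⟩ := v
  simp only [EdgeAdj, PkV, ne_eq, Prod.mk.injEq] at *
  omega

lemma pk_step (P : Finset Cell) (B B' f : Cell) (h : EdgeAdj B B') (hB : B ∈ P) (hB' : B' ∈ P)
    (hf : PkV B f) : ∃ f' v o : Cell, PkV B' f' ∧ ¬ PkV B f' ∧ PkV B' v ∧ ¬ PkV B v ∧ f' ≠ v ∧
      PkV B o ∧ (PkV B' f → PkV B' o) ∧ PkRect P f v o f' ∧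
      (B.2 = B'.2 → f'.2 = f.2 ∧ v.2 = o.2 ∧ v.1 = f'.1) ∧
      (B.1 = B'.1 → f'.1 = f.1 ∧ v.1 = o.1 ∧ v.2 = f'.2) := by
  obtain ⟨a1, a2⟩ := B
  obtain ⟨b1, b2⟩ := B'
  obtain ⟨f1, f2⟩ := f
  simp only [EdgeAdj, PkV] at h hf
  have key : ∀ far : ℤ, ∀ c : Cell, (c = (a1, a2) ∨ c = (b1, b2)) → c ∈ P := by
    rintro - c (rfl | rfl) <;> assumption
  rcases h with ⟨h1, h2⟩ | ⟨h1, h2⟩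
  · obtain ⟨far, hfar⟩ : ∃ far : ℤ, (a2 = b2 + 1 ∧ far = b2) ∨ (b2 = a2 + 1 ∧ far = b2 + 1) := by
      rcases h2 with h2 | h2
      · exact ⟨b2, Or.inl ⟨h2, rfl⟩⟩
      · exact ⟨b2 + 1, Or.inr ⟨h2, rfl⟩⟩
    refine ⟨(f1, far), (2 * a1 + 1 - f1, far), (2 * a1 + 1 - f1, f2), ?_, ?_, ?_, ?_, ?_, ?_, ?_,
      ⟨?_, ?_, Or.inr ⟨rfl, rfl⟩, ?_⟩, ?_, ?_⟩ <;>
      simp only [PkV, ne_eq, Prod.mk.injEq] <;> try first | omega | exact fun _ => ⟨trivial, trivial, trivial⟩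
    rintro ⟨c1, c2⟩ g1 g2 g3 g4
    apply key 0
    simp only [Prod.mk.injEq] at *
    omega
  · obtain ⟨far, hfar⟩ : ∃ far : ℤ, (a1 = b1 + 1 ∧ far = b1) ∨ (b1 = a1 + 1 ∧ far = b1 + 1) := by
      rcases h2 with h2 | h2
      · exact ⟨b1, Or.inl ⟨h2, rfl⟩⟩
      · exact ⟨b1 + 1, Or.inr ⟨h2, rfl⟩⟩
    refine ⟨(far, f2), (far, 2 * a2 + 1 - f2), (f1, 2 * a2 + 1 - f2), ?_, ?_, ?_, ?_, ?_, ?_, ?_,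
      ⟨?_, ?_, Or.inl ⟨rfl, rfl⟩, ?_⟩, ?_, ?_⟩ <;>
      simp only [PkV, ne_eq, Prod.mk.injEq] <;> try first | omega | exact fun _ => ⟨trivial, trivial, trivial⟩
    rintro ⟨c1, c2⟩ g1 g2 g3 g4
    apply key 0
    simp only [Prod.mk.injEq] at *
    omega

lemma pk_unit_orth {d e : Cell} (hd : UnitVec d) (he : UnitVec e) (ho : Orth d e) :
    ∃ s t : ℤ, (s = 1 ∨ s = -1) ∧ (t = 1 ∨ t = -1) ∧
      ((d = (s, 0) ∧ e = (0, t)) ∨ (d = (0, s) ∧ e = (t, 0))) := by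
  rcases hd with rfl | rfl | rfl | rfl <;> rcases he with rfl | rfl | rfl | rfl <;>
    simp [Orth] at ho ⊢

set_option maxHeartbeats 2000000 in
lemma pk_geo (a0 d e : Cell) (hd : UnitVec d) (he : UnitVec e) (ho : Orth d e) :
    ∃ p0 x y c2 c3 : Cell,
    (PkV (a0 + d + e) x ∧ PkV (a0 + d + e + d) x ∧ PkV (a0 + d + e) y ∧
      PkV (a0 + d + e + d) y ∧ x ≠ y) ∧
    (PkV (a0 + d) c2 ∧ ¬ PkV a0 c2 ∧ ¬ PkV (a0 + d + e) c2) ∧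
    (PkV (a0 + d + e) c3 ∧ ¬ PkV (a0 + d) c3 ∧ ¬ PkV (a0 + d + e + d) c3) ∧
    (y ≠ c2 ∧ y ≠ c3 ∧ c2 ≠ c3 ∧ p0 ≠ c2 ∧ p0 ≠ c3 ∧ x ≠ c3 ∧ x ≠ c2 ∧ PkV a0 p0 ∧
      PkV a0 (p0 - e) ∧ PkV a0 (p0 - d - e)) ∧
    (∀ c f : Cell, EdgeAdj c a0 → c ≠ a0 + d → (∀ v, PkV c v → ¬ PkV (a0 + d + e) v) →
      PkV a0 f → ¬ PkV c f → f = p0 ∨ f = p0 - d ∨ (f = p0 - e ∧ a0 = c + d)) ∧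
    (∀ P : Finset Cell, a0 ∈ P → a0 + d ∈ P → a0 + d + e ∈ P →
      PkRect P p0 c2 (p0 - e) y ∧ PkRect P (p0 - d) c2 (p0 - d - e) y ∧ PkRect P y c3 p0 x ∧
      PkRect P (p0 - e) y p0 c2 ∧ PkRect P c3 c2 (p0 - e) x) ∧
    (if d.1 = 0 then p0.1 ≠ (p0 - e).1 else p0.2 ≠ (p0 - e).2) := by
  obtain ⟨a, b⟩ := a0
  obtain ⟨s, t, hs, ht, h⟩ := pk_unit_orth hd he ho
  clear hd he ho
  have : ∃ p1 p2 : ℤ, (d = (s, 0) ∧ e = (0, t) ∧ 2 * p1 = 2 * a + 1 + s ∧ 2 * p2 = 2 * b + 1 + t) ∨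
    (d = (0, s) ∧ e = (t, 0) ∧ 2 * p1 = 2 * a + 1 + t ∧ 2 * p2 = 2 * b + 1 + s) := by
    rcases h with ⟨h1, h2⟩ | ⟨h1, h2⟩
    · exact ⟨(2 * a + 1 + s) / 2, (2 * b + 1 + t) / 2, Or.inl ⟨h1, h2, by omega, by omega⟩⟩
    · exact ⟨(2 * a + 1 + t) / 2, (2 * b + 1 + s) / 2, Or.inr ⟨h1, h2, by omega, by omega⟩⟩
  clear h
  obtain ⟨p1, p2, h⟩ := this
  refine ⟨(p1, p2), (p1, p2) + d + e, (p1, p2) + d, (p1, p2) + d - e, (p1, p2) + e, ?_⟩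
  rcases h with ⟨rfl, rfl, h1, h2⟩ | ⟨rfl, rfl, h1, h2⟩
  · refine ⟨?_, ?_, ?_, ?_, ?_, ?_, ?_⟩
    · simp only [PkV, ne_eq, Prod.mk_add_mk, Prod.mk_sub_mk, Prod.mk.injEq]; omega
    · simp only [PkV, ne_eq, Prod.mk_add_mk, Prod.mk_sub_mk, Prod.mk.injEq]; omega
    · simp only [PkV, ne_eq, Prod.mk_add_mk, Prod.mk_sub_mk, Prod.mk.injEq]; omega
    · simp only [PkV, ne_eq, Prod.mk_add_mk, Prod.mk_sub_mk, Prod.mk.injEq]; omega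
    · rintro ⟨c1, c2⟩ ⟨f1, f2⟩ g1 g2 g3 g4 g5
      have g6 : ¬ PkV (c1, c2) (p1, p2) := fun h => g3 _ h (by
        simp only [PkV, Prod.mk_add_mk]; omega)
      clear g3
      simp only [EdgeAdj, PkV, ne_eq, Prod.mk_add_mk, Prod.mk_sub_mk, Prod.mk.injEq] at *
      obtain ⟨g8, g9⟩ := g4
      rcases g1 with ⟨g1, g1' | g1'⟩ | ⟨g1, g1' | g1'⟩ <;> rcases hs with hs | hs <;>
        rcases ht with ht | ht <;> rcases g8 with g8 | g8 <;> rcases g9 with g9 | g9 <;> omega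
    · intro P m0 m1 m2
      simp only [Prod.mk_add_mk, Prod.mk_sub_mk] at *
      refine ⟨?_, ?_, ?_, ?_, ?_⟩ <;>
      · refine ⟨by simp only []; omega, by simp only []; omega, ?_, ?_⟩
        · simp only [Prod.mk.injEq]; omega
        · rintro ⟨c1, c2⟩ g1 g2 g3 g4
          have : (c1, c2) = (a, b) ∨ (c1, c2) = (a + s, b + 0) ∨ (c1, c2) = (a + s + 0, b + 0 + t) := by
            simp only [Prod.mk.injEq] at *
            rcases hs with hs | hs <;> rcases ht with ht | ht <;>
            simp only [hs, ht] at * <;> omega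
          rcases this with h | h | h <;> rw [h] <;> assumption
    · rw [if_neg (by simp only []; omega)]
      simp only [Prod.mk_sub_mk]; omega
  · refine ⟨?_, ?_, ?_, ?_, ?_, ?_, ?_⟩
    · simp only [PkV, ne_eq, Prod.mk_add_mk, Prod.mk_sub_mk, Prod.mk.injEq]; omega
    · simp only [PkV, ne_eq, Prod.mk_add_mk, Prod.mk_sub_mk, Prod.mk.injEq]; omega
    · simp only [PkV, ne_eq, Prod.mk_add_mk, Prod.mk_sub_mk, Prod.mk.injEq]; omega
    · simp only [PkV, ne_eq, Prod.mk_add_mk, Prod.mk_sub_mk, Prod.mk.injEq]; omega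
    · rintro ⟨c1, c2⟩ ⟨f1, f2⟩ g1 g2 g3 g4 g5
      have g6 : ¬ PkV (c1, c2) (p1, p2) := fun h => g3 _ h (by
        simp only [PkV, Prod.mk_add_mk]; omega)
      clear g3
      simp only [EdgeAdj, PkV, ne_eq, Prod.mk_add_mk, Prod.mk_sub_mk, Prod.mk.injEq] at *
      obtain ⟨g8, g9⟩ := g4
      rcases g1 with ⟨g1, g1' | g1'⟩ | ⟨g1, g1' | g1'⟩ <;> rcases hs with hs | hs <;>
        rcases ht with ht | ht <;> rcases g8 with g8 | g8 <;> rcases g9 with g9 | g9 <;> omega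
    · intro P m0 m1 m2
      simp only [Prod.mk_add_mk, Prod.mk_sub_mk] at *
      refine ⟨?_, ?_, ?_, ?_, ?_⟩ <;>
      · refine ⟨by simp only []; omega, by simp only []; omega, ?_, ?_⟩
        · simp only [Prod.mk.injEq]; omega
        · rintro ⟨c1, c2⟩ g1 g2 g3 g4
          have : (c1, c2) = (a, b) ∨ (c1, c2) = (a + 0, b + s) ∨ (c1, c2) = (a + 0 + t, b + s + 0) := by
            simp only [Prod.mk.injEq] at *
            rcases hs with hs | hs <;> rcases ht with ht | ht <;>
            simp only [hs, ht] at * <;> omega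
          rcases this with h | h | h <;> rw [h] <;> assumption
    · rw [if_pos rfl]
      simp only [Prod.mk_sub_mk]; omega

lemma pk_phi {d B B' f f' v o : Cell} (hd : UnitVec d) (hadj : EdgeAdj B B')
    (h1 : f.1 ≠ v.1) (h2 : f.2 ≠ v.2)
    (h3 : B.2 = B'.2 → f'.2 = f.2 ∧ v.2 = o.2 ∧ v.1 = f'.1)
    (h4 : B.1 = B'.1 → f'.1 = f.1 ∧ v.1 = o.1 ∧ v.2 = f'.2)
    (φ : Cell → ℤ) (hφ : φ = fun w => if d.1 = 0 then w.1 else w.2) :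
    (B' = B + d → φ f' = φ f ∧ φ v = φ o ∧ φ f ≠ φ v) ∧
    (B' ≠ B + d → B ≠ B' + d → φ v = φ f') := by
  obtain ⟨a1, a2⟩ := B
  obtain ⟨b1, b2⟩ := B'
  rcases hd with rfl | rfl | rfl | rfl <;> subst hφ <;>
    simp only [EdgeAdj, Prod.mk_add_mk, ne_eq, Prod.mk.injEq] at * <;> simp <;> omega

end Comb

section Final

/-- ranks for the chain of steps -/
lemma pk_base (N : ℕ) (F v O : ℕ → Cell) (V : ℕ → Cell → Prop)
    (hFn : ∀ j, ¬ V j (F (j + 1))) (hvn : ∀ j, ¬ V j (v (j + 1)))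
    (hFv : ∀ j, F (j + 1) ≠ v (j + 1)) (hO : ∀ j, V j (O (j + 1)))
    (hOld : ∀ j k, j + 1 < k → k ≤ N → ∀ w, w = O (j + 1) ∨ w = F (j + 1) ∨ w = v (j + 1) →
      w ≠ F k ∧ w ≠ v k) :
    ∀ m ≤ N, ∃ (ρ : Cell → ℤ) (M : ℤ), (∀ w, ρ w ≤ M) ∧
      ∀ j < m, ρ (O (j + 1)) < ρ (v (j + 1)) ∧ ρ (F (j + 1)) < ρ (v (j + 1)) := by
  intro m
  induction m with
  | zero => intro _; exact ⟨fun _ => 0, 0, fun _ => le_rfl, fun j hj => absurd hj (by omega)⟩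
  | succ m ih =>
    intro hm
    obtain ⟨ρ, M, h1, h2⟩ := ih (by omega)
    refine ⟨fun w => if w = v (m + 1) then M + 2 else if w = F (m + 1) then M + 1 else ρ w, M + 2,
      ?_, ?_⟩
    · intro w
      have := h1 w
      dsimp only
      split_ifs <;> omega
    · intro j hj
      dsimp only
      rcases Nat.lt_succ_iff_lt_or_eq.1 hj with hj | rfl
      · have a := hOld j (m + 1) (by omega) hm _ (Or.inl rfl)
        have b := hOld j (m + 1) (by omega) hm _ (Or.inr (Or.inl rfl))
        have c := hOld j (m + 1) (by omega) hm _ (Or.inr (Or.inr rfl))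
        rw [if_neg a.2, if_neg a.1, if_neg b.2, if_neg b.1, if_neg c.2, if_neg c.1]
        exact h2 j hj
      · have x1 : O (j + 1) ≠ v (j + 1) := fun h => hvn j (h ▸ hO j)
        have x2 : O (j + 1) ≠ F (j + 1) := fun h => hFn j (h ▸ hO j)
        rw [if_pos rfl, if_neg (hFv j), if_pos rfl, if_neg x1, if_neg x2]
        have := h1 (O (j + 1))
        omega

lemma pk_asm (K : Type*) [Field K] (P : Finset Cell) (N : ℕ) (hcard : P.card = N + 2)
    (F v O : ℕ → Cell) (e1 e2 e3 r1 s1 r2 s2 : Cell)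
    (hR : ∀ j < N, PkRect P (F j) (v (j + 1)) (O (j + 1)) (F (j + 1)))
    (hR1 : PkRect P (F N) e2 r1 s1) (hR2 : PkRect P e1 e3 r2 s2)
    (hFF : ∀ i j, i < j → j ≤ N → F i ≠ F j)
    (hvv : ∀ i j, i < j → j < N → v (i + 1) ≠ v (j + 1))
    (hFv : ∀ i ≤ N, ∀ j < N, F i ≠ v (j + 1))
    (h12 : e1 ≠ e2) (h13 : e1 ≠ e3) (h23 : e2 ≠ e3)
    (hF1 : ∀ i ≤ N, F i ≠ e1) (hF2 : ∀ i ≤ N, F i ≠ e2) (hF3 : ∀ i ≤ N, F i ≠ e3)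
    (hv1 : ∀ i < N, v (i + 1) ≠ e1) (hv2 : ∀ i < N, v (i + 1) ≠ e2)
    (hv3 : ∀ i < N, v (i + 1) ≠ e3)
    (ρ : Cell → ℤ)
    (hρ : ∀ j < N, (ρ (O (j + 1)) < ρ (F j) ∧ ρ (F (j + 1)) < ρ (F j)) ∨
      (ρ (O (j + 1)) < ρ (v (j + 1)) ∧ ρ (F (j + 1)) < ρ (v (j + 1))))
    (hρ1 : (ρ r1 < ρ (F N) ∧ ρ s1 < ρ (F N)) ∨ (ρ r1 < ρ e2 ∧ ρ s1 < ρ e2))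
    (hρ2 : (ρ r2 < ρ e1 ∧ ρ s2 < ρ e1) ∨ (ρ r2 < ρ e3 ∧ ρ s2 < ρ e3)) :
    IsKoenigType (polyIdeal K P) := by
  have hcs : ∀ i < N + 2, i < N ∨ i = N ∨ i = N + 1 := by intro i hi; omega
  have pe : ∀ i ≤ N, (if i ≤ N then F i else e1) = F i := fun i hi => if_pos hi
  have n1 : ¬ (N + 1 ≤ N) := by omega
  have n2 : ¬ (N + 1 < N) := by omega
  have n3 : ¬ (N + 1 = N) := by omega
  refine pk_cert K P (N + 2) hcard
    (fun i => if i ≤ N then F i else e1)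
    (fun i => if i < N then (fun i => v (i + 1)) i else if i = N then e2 else e3)
    (fun i => if i < N then (fun i => O (i + 1)) i else if i = N then r1 else r2)
    (fun i => if i < N then (fun i => F (i + 1)) i else if i = N then s1 else s2)
    ?_ ?_ ?_ ?_ ρ ?_
  · intro i hi
    beta_reduce
    rcases hcs i hi with h | rfl | rfl
    · simp only [h, h.le, if_true]; exact hR i h
    · simp only [le_refl, lt_irrefl, if_true, if_false]; exact hR1
    · simp only [n1, n2, n3, if_false]; exact hR2
  · have : ∀ i j, i < j → j < N + 2 →
        (if i ≤ N then F i else e1) ≠ (if j ≤ N then F j else e1) := by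
      intro i j hij hj
      rw [pe i (by omega)]
      split_ifs with h
      · exact hFF i j hij h
      · exact hF1 i (by omega)
    intro i hi j hj h
    rcases lt_trichotomy i j with g | g | g
    · exact absurd h (this i j g hj)
    · exact g
    · exact absurd h.symm (this j i g hi)
  · have : ∀ i j, i < j → j < N + 2 →
        (if i < N then v (i + 1) else if i = N then e2 else e3) ≠
        (if j < N then v (j + 1) else if j = N then e2 else e3) := by
      intro i j hij hj
      split_ifs with h1 h2 h3 h4 h5 h6
      · exact hvv i j hij h2
      · exact hv2 i h1
      · exact hv3 i h1
      all_goals first | omega | exact h23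
    intro i hi j hj h
    rcases lt_trichotomy i j with g | g | g
    · exact absurd h (this i j g hj)
    · exact g
    · exact absurd h.symm (this j i g hi)
  · intro i hi j hj
    beta_reduce
    split_ifs with h1 h2 h3 h4 h5
    · exact hFv i h1 j h2
    · exact hF2 i h1
    · exact hF3 i h1
    · exact (hv1 j h4).symm
    · exact h12
    · exact h13
  · intro i hi
    beta_reduce
    rcases hcs i hi with h | rfl | rfl
    · simp only [h, h.le, if_true]; exact hρ i h
    · simp only [le_refl, lt_irrefl, if_true, if_false]; exact hρ1
    · simp only [n1, n2, n3, if_false]; exact hρ2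

end Final

section Main

lemma pk_not_all (N : ℕ) (b : ℕ → Cell) (d e : Cell) (hd : UnitVec d) (he : UnitVec e)
    (ho : Orth d e) (hs2 : b 0 = b N + d + e) :
    ¬ (∀ j, 0 < j → j ≤ N → b j = b (j - 1) + d) := by
  intro h
  have key : ∀ m : ℕ, m ≤ N → (b m).1 = (b 0).1 + m * d.1 ∧ (b m).2 = (b 0).2 + m * d.2 := by
    intro m
    induction m with
    | zero => intro _; simp
    | succ m ih =>
      intro hm
      have h1 := ih (by omega)
      have h2 := h (m + 1) (by omega) hm
      rw [Nat.add_sub_cancel] at h2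
      rw [h2, Prod.fst_add, Prod.snd_add, h1.1, h1.2]
      push_cast
      constructor <;> ring
  have k := key N le_rfl
  have e1 := congrArg Prod.fst hs2
  have e2 := congrArg Prod.snd hs2
  obtain ⟨s, t, hs, ht, h⟩ := pk_unit_orth hd he ho
  rcases h with ⟨rfl, rfl⟩ | ⟨rfl, rfl⟩ <;> simp at e1 e2 k <;> omega

lemma pk_T (N : ℕ) (Q : ℕ → Prop) (h : ¬ ∀ j, 0 < j → j ≤ N → Q j) :
    ∃ T, 0 < T ∧ T ≤ N ∧ ¬ Q T ∧ ∀ j, T < j → j ≤ N → Q j := by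
  induction N with
  | zero => exact absurd (fun j h1 h2 => absurd h1 (by omega)) h
  | succ N ih =>
    by_cases hq : Q (N + 1)
    · obtain ⟨T, h1, h2, h3, h4⟩ := ih (fun h' => h (fun j g1 g2 => by
        rcases Nat.lt_or_ge j (N + 1) with g | g
        · exact h' j g1 (by omega)
        · have : j = N + 1 := by omega
          rwa [this]))
      refine ⟨T, h1, by omega, h3, fun j g1 g2 => ?_⟩
      rcases Nat.lt_or_ge j (N + 1) with g | g
      · exact h4 j g1 (by omega)
      · have : j = N + 1 := by omega
        rwa [this]
    · exact ⟨N + 1, by omega, le_rfl, hq, fun j g1 g2 => absurd g1 (by omega)⟩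

lemma pk_rank (F : ℕ → Cell) (N T : ℕ) (hFF : ∀ i j, i < j → j ≤ N → F i ≠ F j) (M : ℤ)
    (ρ : Cell → ℤ) (h1 : ∀ w, ρ w ≤ M) : ∃ g : Cell → ℤ,
      (∀ j, T ≤ j → j ≤ N → g (F j) = M + 1 + N - (j : ℤ)) ∧
      (∀ w, (∀ j, T ≤ j → j ≤ N → w ≠ F j) → g w = ρ w) ∧ ∀ w, g w ≤ M + 1 + N := by
  classical
  have hex : ∀ w, ∃ z : ℤ, (∀ j, T ≤ j → j ≤ N → F j = w → z = M + 1 + N - (j : ℤ)) ∧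
      ((∀ j, T ≤ j → j ≤ N → w ≠ F j) → z = ρ w) ∧ z ≤ M + 1 + N := by
    intro w
    by_cases hw : ∃ j, T ≤ j ∧ j ≤ N ∧ F j = w
    · obtain ⟨j, a1, a2, a3⟩ := hw
      refine ⟨M + 1 + N - (j : ℤ), ?_, fun h => absurd a3.symm (h j a1 a2), by omega⟩
      intro i b1 b2 b3
      rcases lt_trichotomy i j with g | g | g
      · exact absurd (b3.trans a3.symm) (hFF _ _ g a2)
      · rw [g]
      · exact absurd (a3.trans b3.symm) (hFF _ _ g b2)
    · refine ⟨ρ w, fun j a1 a2 a3 => absurd ⟨j, a1, a2, a3⟩ hw, fun _ => rfl, ?_⟩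
      have := h1 w
      omega
  choose g hg using hex
  exact ⟨g, fun j a1 a2 => (hg (F j)).1 j a1 a2 rfl, fun w => (hg w).2.1, fun w => (hg w).2.2⟩

theorem pk_main (K : Type*) [Field K] (P : Finset Cell) (N : ℕ) (hN : 4 ≤ N)
    (hcard : P.card = N + 2) (b : ℕ → Cell) (hadj : ∀ j, EdgeAdj (b j) (b (j + 1)))
    (hmem : ∀ j, b j ∈ P) (hne2 : ∀ j, b j ≠ b (j + 2)) (hper : ∀ j, b (j + (N + 2)) = b j)
    (H3 : ∀ j k, j + 3 ≤ k → k + 1 ≤ j + N → ∀ w, PkV (b j) w → ¬ PkV (b k) w)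
    (d e : Cell) (hd : UnitVec d) (he : UnitVec e) (ho : Orth d e)
    (hs1 : b (N + 1) = b N + d) (hs2 : b 0 = b N + d + e) (hs3 : b 1 = b N + d + e + d) :
    IsKoenigType (polyIdeal K P) := by
  classical
  obtain ⟨p0, x, y, c2, c3, ⟨x0, x1, y0, y1, hxy⟩, ⟨c2a, c2b, c2c⟩, ⟨c3a, c3b, c3c⟩,
    ⟨hyc2, hyc3, hc23, hpc2, hpc3, hxc3, hxc2, hp0, hpe, hpde⟩, htri, hrect, hphi⟩ :=
    pk_geo (b N) d e hd he ho
  have hN2 : b (N + 2) = b 0 := by simpa using hper 0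
  have hN3 : b (N + 3) = b 1 := by
    have := hper 1
    rwa [show 1 + (N + 2) = N + 3 by omega] at this
  rw [← hs3] at x1 y1 c3c
  rw [← hs2] at x0 y0 c2c c3a htri hrect
  rw [← hs1] at c2a c3b htri hrect
  -- local structure
  have W : ∀ j w, PkV (b j) w → PkV (b (j + 2)) w → PkV (b (j + 1)) w := fun j w h1 h2 =>
    pk_W (hadj j) (hadj (j + 1)) (hne2 j) h1 h2
  have hnew : ∀ i k w, 1 ≤ i → i ≤ k → k + 1 ≤ N → ¬ PkV (b k) w → PkV (b (k + 1)) w →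
      ¬ PkV (b i) w := by
    intro i k w h1 h2 h3 h4 h5 h6
    rcases Nat.lt_or_ge (i + 2) (k + 1) with h | h
    · exact H3 i (k + 1) (by omega) (by omega) w h6 h5
    · rcases (by omega : k = i ∨ k = i + 1) with rfl | rfl
      · exact h4 h6
      · exact h4 (W i w h6 h5)
  have hc2 : ∀ j, 1 ≤ j → j ≤ N → ¬ PkV (b j) c2 := by
    intro j h1 h2 h
    rcases (by omega : j = 1 ∨ j = N ∨ j = N - 1 ∨ (2 ≤ j ∧ j + 2 ≤ N)) with rfl | rfl | rfl | h3
    · have := W (N + 1) c2 c2a (by rwa [show N + 1 + 2 = N + 3 by omega, hN3])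
      rw [show N + 1 + 1 = N + 2 by omega, hN2] at this
      exact c2c this
    · exact c2b h
    · have := W (N - 1) c2 h (by rwa [show N - 1 + 2 = N + 1 by omega])
      rw [show N - 1 + 1 = N by omega] at this
      exact c2b this
    · exact H3 j (N + 1) (by omega) (by omega) c2 h c2a
  have hc3 : ∀ j, 1 ≤ j → j ≤ N → ¬ PkV (b j) c3 := by
    intro j h1 h2 h
    rcases (by omega : j = 1 ∨ j = 2 ∨ j = N ∨ (3 ≤ j ∧ j + 1 ≤ N)) with rfl | rfl | rfl | h3
    · exact c3c h
    · exact c3c (W 0 c3 c3a h)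
    · exact c3b (W j c3 h (by rwa [hN2]))
    · exact H3 0 j (by omega) (by omega) c3 c3a h
  -- the chain
  have hstep := fun j f hf => pk_step P (b j) (b (j + 1)) f (hadj j) (hmem j) (hmem (j + 1)) hf
  choose! f' v' o' hst using hstep
  let F : ℕ → Cell := fun j => Nat.rec x (fun k f => f' k f) j
  have hF0 : F 0 = x := rfl
  have hFs : ∀ j, F (j + 1) = f' j (F j) := fun _ => rfl
  have hFV : ∀ j, PkV (b j) (F j) := by
    intro j
    induction j with
    | zero => exact x0
    | succ j ih => rw [hFs]; exact (hst j _ ih).1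
  obtain ⟨v, hv⟩ : ∃ v : ℕ → Cell, ∀ j, v (j + 1) = v' j (F j) :=
    ⟨fun j => v' (j - 1) (F (j - 1)), fun j => by simp⟩
  obtain ⟨O, hO⟩ : ∃ O : ℕ → Cell, ∀ j, O (j + 1) = o' j (F j) :=
    ⟨fun j => o' (j - 1) (F (j - 1)), fun j => by simp⟩
  have hst' := fun j => hst j (F j) (hFV j)
  simp only [← hFs, ← hv, ← hO] at hst'
  have hFn : ∀ j, ¬ PkV (b j) (F (j + 1)) := fun j => (hst' j).2.1
  have hvV : ∀ j, PkV (b (j + 1)) (v (j + 1)) := fun j => (hst' j).2.2.1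
  have hvn : ∀ j, ¬ PkV (b j) (v (j + 1)) := fun j => (hst' j).2.2.2.1
  have hFv : ∀ j, F (j + 1) ≠ v (j + 1) := fun j => (hst' j).2.2.2.2.1
  have hOV : ∀ j, PkV (b j) (O (j + 1)) := fun j => (hst' j).2.2.2.2.2.1
  have hO1 : PkV (b 1) (O 1) := (hst' 0).2.2.2.2.2.2.1 x1
  have hR : ∀ j, PkRect P (F j) (v (j + 1)) (O (j + 1)) (F (j + 1)) :=
    fun j => (hst' j).2.2.2.2.2.2.2.1
  have hdir := fun j => (hst' j).2.2.2.2.2.2.2.2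
  clear hst hst' hv hO
  have hFnew : ∀ i k, 1 ≤ i → i < k → k ≤ N → ¬ PkV (b i) (F k) := by
    intro i k h1 h2 h3
    obtain ⟨k, rfl⟩ : ∃ k', k = k' + 1 := ⟨k - 1, by omega⟩
    exact hnew i k _ h1 (by omega) h3 (hFn k) (hFV (k + 1))
  have hvnew : ∀ i k, 1 ≤ i → i < k → k ≤ N → ¬ PkV (b i) (v k) := by
    intro i k h1 h2 h3
    obtain ⟨k, rfl⟩ : ∃ k', k = k' + 1 := ⟨k - 1, by omega⟩
    exact hnew i k _ h1 (by omega) h3 (hvn k) (hvV k)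
  have neF : ∀ i k w, 1 ≤ i → i < k → k ≤ N → PkV (b i) w → w ≠ F k ∧ w ≠ v k := by
    intro i k w h1 h2 h3 h4
    exact ⟨fun h => hFnew i k h1 h2 h3 (h ▸ h4), fun h => hvnew i k h1 h2 h3 (h ▸ h4)⟩
  have hOwit : ∀ j, ∃ i, 1 ≤ i ∧ i ≤ j + 1 ∧ (j ≠ 0 → i ≤ j) ∧ PkV (b i) (O (j + 1)) := by
    intro j
    rcases Nat.eq_zero_or_pos j with rfl | h
    · exact ⟨1, le_rfl, le_rfl, fun h => absurd rfl h, hO1⟩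
    · exact ⟨j, h, by omega, fun _ => le_rfl, hOV j⟩
  have hOld : ∀ j k, j + 1 < k → k ≤ N → ∀ w, w = O (j + 1) ∨ w = F (j + 1) ∨ w = v (j + 1) →
      w ≠ F k ∧ w ≠ v k := by
    intro j k h1 h2 w hw
    rcases hw with rfl | rfl | rfl
    · obtain ⟨i, a1, a2, -, a3⟩ := hOwit j
      exact neF i k _ a1 (by omega) h2 a3
    · exact neF (j + 1) k _ (by omega) h1 h2 (hFV _)
    · exact neF (j + 1) k _ (by omega) h1 h2 (hvV _)
  have base := pk_base N F v O (fun j => PkV (b j)) hFn hvn hFv hOV hOld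
  -- vertices of the first cells
  have ne01 : ∀ w, PkV (b 0) w → PkV (b 1) w → ∀ k, 1 ≤ k → k ≤ N → w ≠ F k ∧ w ≠ v k := by
    intro w h0 h1 k k1 k2
    rcases (by omega : k = 1 ∨ 1 < k) with rfl | h
    · exact ⟨fun h => hFn 0 (h ▸ h0), fun h => hvn 0 (h ▸ h0)⟩
    · exact neF 1 k w le_rfl h k2 h1
  have hFF : ∀ i j, i < j → j ≤ N → F i ≠ F j := by
    intro i j h1 h2
    rcases Nat.eq_zero_or_pos i with rfl | h
    · exact (ne01 _ x0 x1 j (by omega) h2).1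
    · exact (neF i j _ h h1 h2 (hFV i)).1
  have hvv : ∀ i j, i < j → j < N → v (i + 1) ≠ v (j + 1) := by
    intro i j h1 h2
    exact (neF (i + 1) (j + 1) _ (by omega) (by omega) h2 (hvV i)).2
  have hFv' : ∀ i ≤ N, ∀ j < N, F i ≠ v (j + 1) := by
    intro i hi j hj
    rcases Nat.eq_zero_or_pos i with rfl | h
    · exact (ne01 _ x0 x1 (j + 1) (by omega) hj).2
    rcases lt_trichotomy i (j + 1) with g | g | g
    · exact (neF i (j + 1) _ h g hj (hFV i)).2
    · rw [g]; exact hFv j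
    · exact (neF (j + 1) i _ (by omega) g hi (hvV j)).1.symm
  have hFy : ∀ i ≤ N, F i ≠ y := by
    intro i hi
    rcases Nat.eq_zero_or_pos i with rfl | h
    · exact hxy
    · exact (ne01 _ y0 y1 i h hi).1.symm
  have hvy : ∀ i < N, v (i + 1) ≠ y := fun i hi => (ne01 _ y0 y1 (i + 1) (by omega) hi).2.symm
  have hFx : ∀ c, x ≠ c → (∀ j, 1 ≤ j → j ≤ N → ¬ PkV (b j) c) → ∀ i ≤ N, F i ≠ c := by
    intro c h1 h2 i hi
    rcases Nat.eq_zero_or_pos i with rfl | h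
    · exact h1
    · exact fun h' => h2 i h hi (h' ▸ hFV i)
  have hvx : ∀ c, (∀ j, 1 ≤ j → j ≤ N → ¬ PkV (b j) c) → ∀ i < N, v (i + 1) ≠ c := by
    intro c h2 i hi h'
    exact h2 (i + 1) (by omega) hi (h' ▸ hvV i)
  have hOx : ∀ c, (∀ j, 1 ≤ j → j ≤ N → ¬ PkV (b j) c) → ∀ i < N, O (i + 1) ≠ c := by
    intro c h2 i hi h'
    obtain ⟨k, a1, a2, -, a3⟩ := hOwit i
    exact h2 k a1 (by omega) (h' ▸ a3)
  have hFc2 := hFx c2 hxc2 hc2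
  have hFc3 := hFx c3 hxc3 hc3
  have hvc2 := hvx c2 hc2
  have hvc3 := hvx c3 hc3
  have hOc2 := hOx c2 hc2
  have hOc3 := hOx c3 hc3
  have notN : ∀ w, PkV (b N) w → w ≠ c2 ∧ w ≠ c3 := fun w h =>
    ⟨fun h' => hc2 N (by omega) le_rfl (h' ▸ h), fun h' => hc3 N (by omega) le_rfl (h' ▸ h)⟩
  obtain ⟨R1, R2, R3, R4, R5⟩ := hrect P (hmem _) (hmem _) (hmem _)
  have hlast : EdgeAdj (b (N - 1)) (b N) := by
    have := hadj (N - 1)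
    rwa [show N - 1 + 1 = N by omega] at this
  have hFN := htri (b (N - 1)) (F N) hlast
    (by have := hne2 (N - 1); rwa [show N - 1 + 2 = N + 1 by omega] at this)
    (fun w h h' => H3 0 (N - 1) (by omega) (by omega) w h' h) (hFV N)
    (by have := hFn (N - 1); rwa [show N - 1 + 1 = N by omega] at this)
  have good : ∀ r1, PkRect P (F N) c2 r1 y → r1 ≠ c2 → r1 ≠ c3 → IsKoenigType (polyIdeal K P) := by
    intro r1 hr1 g1 g2
    obtain ⟨ρ, M, h1, h2⟩ := base N le_rfl
    refine pk_asm K P N hcard F v O y c2 c3 r1 y p0 x (fun j _ => hR j) hr1 R3 hFF hvv hFv'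
      hyc2 hyc3 hc23 hFy hFc2 hFc3 hvy hvc2 hvc3
      (fun w => if w = c3 then M + 2 else if w = c2 then M + 1 else ρ w) ?_ ?_ ?_
    · intro j hj
      right
      beta_reduce
      rw [if_neg (hOc3 j hj), if_neg (hOc2 j hj), if_neg (hvc3 j hj), if_neg (hvc2 j hj),
        if_neg (hFc3 (j + 1) hj), if_neg (hFc2 (j + 1) hj)]
      exact h2 j hj
    · right
      beta_reduce
      rw [if_neg g2, if_neg g1, if_neg hc23, if_pos rfl, if_neg hyc3, if_neg hyc2]
      have := h1 r1
      have := h1 y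
      omega
    · right
      beta_reduce
      rw [if_neg hpc3, if_neg hpc2, if_pos rfl, if_neg hxc3, if_neg hxc2]
      have := h1 p0
      have := h1 x
      omega
  rcases hFN with h | h | ⟨h, hdN⟩
  · exact good (p0 - e) (h ▸ R1) (notN _ hpe).1 (notN _ hpe).2
  · exact good (p0 - d - e) (h ▸ R2) (notN _ hpde).1 (notN _ hpde).2
  -- the remaining case
  obtain ⟨T, T1, T2, T3, T4⟩ := pk_T N (fun j => b j = b (j - 1) + d)
    (pk_not_all N b d e hd he ho hs2)
  have hTN : T ≠ N := by rintro rfl; exact T3 hdN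
  have hT1 : T ≠ 1 := by rintro rfl; exact T3 (by rw [hs3, hs2])
  have T5 : b (T - 1) ≠ b T + d := by
    intro h'
    have q1 := T4 (T + 1) (by omega) (by omega)
    rw [Nat.add_sub_cancel] at q1
    have q2 := hne2 (T - 1)
    rw [show T - 1 + 2 = T + 1 by omega, q1] at q2
    exact q2 h'
  obtain ⟨φ, hφ⟩ : ∃ φ : Cell → ℤ, φ = fun w => if d.1 = 0 then w.1 else w.2 := ⟨_, rfl⟩
  have hph := fun j => pk_phi hd (hadj j) (hR j).1 (hR j).2.1 (hdir j).1 (hdir j).2 φ hφ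
  have hφ0 : φ p0 ≠ φ (p0 - e) := by
    rw [hφ]
    beta_reduce
    split_ifs at hphi ⊢ <;> exact hphi
  have hφs : ∀ j, T ≤ j → j < N →
      φ (F (j + 1)) = φ (F j) ∧ φ (v (j + 1)) = φ (O (j + 1)) ∧ φ (F j) ≠ φ (v (j + 1)) := by
    intro j h1 h2
    exact (hph j).1 (T4 (j + 1) (by omega) h2)
  have hφF : ∀ k, k + T ≤ N → φ (F (k + T)) = φ (F T) := by
    intro k
    induction k with
    | zero => intro _; rw [Nat.zero_add]
    | succ k ih =>
      intro hk
      rw [← ih (by omega), show k + 1 + T = (k + T) + 1 by omega]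
      exact (hφs (k + T) (by omega) (by omega)).1
  have hφF' : ∀ j, T ≤ j → j ≤ N → φ (F j) = φ (F T) := by
    intro j h1 h2
    have := hφF (j - T) (by omega)
    rwa [show j - T + T = j by omega] at this
  have hφv : φ (v T) = φ (F T) := by
    have q := (hph (T - 1)).2
    rw [show T - 1 + 1 = T by omega] at q
    exact q T3 T5
  have hφN : φ (p0 - e) = φ (F T) := by rw [← h]; exact hφF' N T2 le_rfl
  obtain ⟨ρ, M, h1, h2⟩ := base (T - 1) (by omega)
  obtain ⟨g, hg1, hg2, hg3⟩ := pk_rank F N T hFF M ρ h1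
  let ρ' : Cell → ℤ := fun w => if w = c3 then M + 3 + N else if w = v T then M + 2 + N else g w
  have vTs : ∀ w, w = v T → ∀ j, T ≤ j → j ≤ N → F j ≠ w := by
    rintro w rfl j g1 g2
    have := hFv' j g2 (T - 1) (by omega)
    rwa [show T - 1 + 1 = T by omega] at this
  have vTc3 : v T ≠ c3 := by
    have := hvc3 (T - 1) (by omega)
    rwa [show T - 1 + 1 = T by omega] at this
  have ρ3 : ρ' c3 = M + 3 + N := if_pos rfl
  have ρv : ρ' (v T) = M + 2 + N := by
    simp only [ρ']
    rw [if_neg vTc3]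
    simp
  have ρF : ∀ j, T ≤ j → j ≤ N → ρ' (F j) = M + 1 + N - (j : ℤ) := by
    intro j g1 g2
    simp only [ρ']
    rw [if_neg (hFc3 j g2), if_neg (fun h' => vTs _ rfl j g1 g2 h')]
    exact hg1 j g1 g2
  have ρold : ∀ w, w ≠ c3 → w ≠ v T → (∀ j, T ≤ j → j ≤ N → w ≠ F j) → ρ' w = ρ w := by
    intro w g1 g2 g3
    simp only [ρ']
    rw [if_neg g1, if_neg g2]
    exact hg2 w g3
  have ρφ : ∀ w, w ≠ c3 → φ w ≠ φ (F T) → ρ' w ≤ M := by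
    intro w g1 g2
    rw [ρold w g1 (fun h' => g2 (by rw [h', hφv]))
      (fun j g4 g5 h' => g2 (by rw [h', hφF' j g4 g5]))]
    exact h1 w
  have ρlt : ∀ w, w ≠ c3 → ρ' w < M + 3 + N := by
    intro w g1
    simp only [ρ']
    rw [if_neg g1]
    have := hg3 w
    split_ifs <;> omega
  refine pk_asm K P N hcard F v O c3 y c2 p0 c2 (p0 - e) x (fun j _ => hR j) (h ▸ R4) R5 hFF hvv
    hFv' hyc3.symm hc23.symm hyc2 hFc3 hFy hFc2 hvc3 hvy hvc2 ρ' ?_ ?_ ?_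
  · intro j hj
    rcases lt_trichotomy (j + 1) T with g | g | g
    · right
      have old : ∀ w, w ≠ c3 → w = O (j + 1) ∨ w = F (j + 1) ∨ w = v (j + 1) → ρ' w = ρ w := by
        intro w a1 a2
        exact ρold w a1 (hOld j T g T2 w a2).2
          (fun k k1 k2 => (hOld j k (by omega) k2 w a2).1)
      rw [old _ (hOc3 j hj) (Or.inl rfl), old _ (hFc3 (j + 1) hj) (Or.inr (Or.inl rfl)),
        old _ (hvc3 j hj) (Or.inr (Or.inr rfl))]
      exact h2 j (by omega)
    · right
      have q1 : ρ' (O (j + 1)) = ρ (O (j + 1)) := by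
        have hj1 : 1 ≤ j := by omega
        refine ρold _ (hOc3 j hj) (neF j T _ hj1 (by omega) T2 (hOV j)).2
          (fun k k1 k2 => (neF j k _ hj1 (by omega) k2 (hOV j)).1)
      rw [q1, ρF (j + 1) (by omega) hj, g, ρv]
      have := h1 (O T)
      omega
    · left
      have q := hφs j (by omega) hj
      have q1 : ρ' (O (j + 1)) ≤ M := ρφ _ (hOc3 j hj) (by
        rw [← q.2.1, ← hφF' j (by omega) hj.le]; exact q.2.2.symm)
      rw [ρF j (by omega) hj.le, ρF (j + 1) (by omega) hj]
      push_cast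
      omega
  · left
    have q1 : ρ' p0 ≤ M := ρφ _ hpc3 (by rw [← hφN]; exact hφ0)
    have q2 : ρ' c2 ≤ M := by
      rw [ρold c2 hc23 (by
        have := hvc2 (T - 1) (by omega)
        rw [show T - 1 + 1 = T by omega] at this
        exact this.symm) (fun j _ g2 => (hFc2 j g2).symm)]
      exact h1 c2
    rw [ρF N T2 le_rfl]
    omega
  · left
    rw [ρ3]
    exact ⟨ρlt _ (notN _ hpe).2, ρlt _ hxc3⟩

end Main

/-- Let `P` be a closed path polyomino containing, up to rotations or
reflections and up to relabelling of the cells, a skew configuration of four consecutive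
cells (lower-left corners `(0,0), (1,0), (1,1), (2,1)` after a rotation or reflection).
Then `I_P` is of König type. -/
theorem closedPath_koenig_of_skew (K : Type*) [Field K] (P : Finset Cell) (n : ℕ)
    (hn : 5 < n) (A : ZMod n → Cell) (hA : IsClosedPathSeq n A P)
    (hskew : HasSkewConfig A) :
    IsKoenigType (polyIdeal K P) := by
  obtain ⟨hadj, hinj, hdis, hP⟩ := hA
  obtain ⟨i, d, e, hd, he, ho, k1, k2, k3⟩ := hskew
  haveI : NeZero n := ⟨by omega⟩
  obtain ⟨N, rfl⟩ : ∃ N, n = N + 2 := ⟨n - 2, by omega⟩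
  have hz : ((N : ZMod (N + 2)) + 2) = 0 := by
    have := ZMod.natCast_self (N + 2)
    push_cast at this
    exact this
  have hcard : P.card = N + 2 := by
    have h1 : P = Finset.univ.image A := by
      apply Finset.coe_injective
      rw [hP]; simp
    rw [h1, Finset.card_image_of_injective _ hinj, Finset.card_univ, ZMod.card]
  have hcast : ∀ k : ℤ, ((k : ℤ) : ZMod (N + 2)) = 0 → ((N : ℤ) + 2) ∣ k := by
    intro k hk
    have := (ZMod.intCast_zmod_eq_zero_iff_dvd k (N + 2)).1 hk
    push_cast at this
    exact this
  have hsmall : ∀ k : ℤ, ((k : ℤ) : ZMod (N + 2)) = 0 → 0 < k → k < N + 2 → False := by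
    intro k hk h1 h2
    have := Int.le_of_dvd h1 (hcast k hk)
    omega
  have hN0 : i + 2 + ((N : ℕ) : ZMod (N + 2)) = i := by
    rw [add_assoc, add_comm 2, hz, add_zero]
  refine pk_main K P N (by omega) hcard (fun j => A (i + 2 + (j : ZMod (N + 2)))) ?_ ?_ ?_ ?_ ?_
    d e hd he ho ?_ ?_ ?_
  · intro j
    have := hadj (i + 2 + j)
    beta_reduce
    rw [Nat.cast_succ, ← add_assoc]
    exact this
  · intro j
    have : A (i + 2 + j) ∈ (P : Set Cell) := by rw [hP]; exact ⟨_, rfl⟩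
    exact this
  · intro j h
    have h' := hinj h
    push_cast at h'
    apply hsmall 2 _ (by omega) (by omega)
    push_cast
    linear_combination -h'
  · intro j
    beta_reduce
    congr 1
    push_cast
    linear_combination hz
  · intro j k h1 h2 w w1 w2
    have := hdis (i + 2 + j) (i + 2 + k) (by
      simp only [Set.mem_insert_iff, Set.mem_singleton_iff, not_or]
      have key : ∀ t : ℤ, -3 < t → t < 3 →
          (i + 2 + (k : ZMod (N + 2))) ≠ i + 2 + (j : ZMod (N + 2)) + (t : ℤ) := by
        intro t t1 t2 h
        apply hsmall ((k : ℤ) - j - t) _ (by omega) (by omega)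
        push_cast
        linear_combination h
      refine ⟨?_, ?_, ?_, ?_, ?_⟩
      · have := key (-2) (by omega) (by omega)
        push_cast at this
        rwa [← sub_eq_add_neg] at this
      · have := key (-1) (by omega) (by omega)
        push_cast at this
        rwa [← sub_eq_add_neg] at this
      · have := key 0 (by omega) (by omega)
        simpa using this
      · have := key 1 (by omega) (by omega)
        simpa using this
      · have := key 2 (by omega) (by omega)
        push_cast at this
        exact this)
    have hm : w ∈ cellVerts (A (i + 2 + j)) ∩ cellVerts (A (i + 2 + k)) :=
      Finset.mem_inter.2 ⟨(pk_V_iff _ _).2 w1, (pk_V_iff _ _).2 w2⟩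
    rw [this] at hm
    exact absurd hm (Finset.notMem_empty _)
  · beta_reduce
    rw [Nat.cast_succ, ← add_assoc, hN0]
    exact k1
  · beta_reduce
    rw [hN0, Nat.cast_zero, add_zero, ← k1]
    exact k2
  · beta_reduce
    rw [hN0, Nat.cast_one, show i + 2 + 1 = i + 3 by ring, k3, k2, k1]
end

section
/- Let P be a closed path polyomino and K a field. Suppose that P has an L-configuration in every change of direction, i.e., every change of direction of the closed path belongs to a path of five cells C_1,…,C_5 of P forming an L-configuration. Then the polyomino ideal I_P is of König type. -/
open scoped MonomialOrder

universe u₁ u₂ u₃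

section AbstractAlgebra
open MvPolynomial

/-- The specialization used to build chains of primes. -/
noncomputable def specHom {σ : Type*} {K : Type*} [Field K] (p : Ideal (MvPolynomial σ K))
    (U : Set σ) : MvPolynomial σ K →+* MvPolynomial σ (MvPolynomial σ K ⧸ p) :=
  open Classical in
  eval₂Hom (C.comp ((Ideal.Quotient.mk p).comp C))
    (fun v => if v ∈ U then C (Ideal.Quotient.mk p (X v)) else X v)

lemma specHom_X_mem {σ : Type*} {K : Type*} [Field K] (p : Ideal (MvPolynomial σ K))
    {U : Set σ} {v : σ} (h : v ∈ U) : specHom p U (X v) = C (Ideal.Quotient.mk p (X v)) := by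
  simp [specHom, h]

lemma specHom_X_not_mem {σ : Type*} {K : Type*} [Field K] (p : Ideal (MvPolynomial σ K))
    {U : Set σ} {v : σ} (h : v ∉ U) : specHom p U (X v) = X v := by
  simp [specHom, h]

/-- The prime attached to a set of variables. -/
noncomputable def specPrime {σ : Type*} {K : Type*} [Field K] (p : Ideal (MvPolynomial σ K))
    [p.IsPrime] (U : Set σ) : PrimeSpectrum (MvPolynomial σ K) :=
  ⟨RingHom.ker (specHom p U), RingHom.ker_isPrime _⟩

lemma specPrime_mono {σ : Type*} {K : Type*} [Field K] (p : Ideal (MvPolynomial σ K))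
    [p.IsPrime] {U U' : Set σ} (h : U ⊆ U') : specPrime p U ≤ specPrime p U' := by
  classical
  let ψ : MvPolynomial σ (MvPolynomial σ K ⧸ p) →+* MvPolynomial σ (MvPolynomial σ K ⧸ p) :=
    eval₂Hom C (fun v => if v ∈ U' then C (Ideal.Quotient.mk p (X v)) else X v)
  have hc : specHom p U' = ψ.comp (specHom p U) := by
    apply MvPolynomial.ringHom_ext
    · intro r
      simp [specHom, ψ]
    · intro v
      by_cases hv : v ∈ U
      · simp [specHom, ψ, hv, h hv]
      · simp [specHom, ψ, hv]
  change RingHom.ker (specHom p U) ≤ RingHom.ker (specHom p U')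
  intro x hx
  rw [RingHom.mem_ker] at hx ⊢
  rw [hc, RingHom.comp_apply, hx, map_zero]

lemma specPrime_univ {σ : Type*} {K : Type*} [Field K] (p : Ideal (MvPolynomial σ K))
    [hp : p.IsPrime] : specPrime p Set.univ ≤ ⟨p, hp⟩ := by
  have hc : specHom p Set.univ = C.comp (Ideal.Quotient.mk p) := by
    apply MvPolynomial.ringHom_ext
    · intro r
      simp [specHom]
    · intro v
      simp [specHom]
  change RingHom.ker (specHom p Set.univ) ≤ p
  intro x hx
  rw [RingHom.mem_ker, hc, RingHom.comp_apply, ← map_zero C] at hx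
  exact Ideal.Quotient.eq_zero_iff_mem.mp (C_injective _ _ hx)

lemma specPrime_step {σ : Type*} {K : Type*} [Field K] (p : Ideal (MvPolynomial σ K))
    [p.IsPrime] {U U' : Set σ} (h : U ⊆ U') (f : MvPolynomial σ K)
    (h1 : specHom p U' f = 0) (h2 : specHom p U f ≠ 0) :
    Order.height (specPrime p U) + 1 ≤ Order.height (specPrime p U') := by
  apply Order.height_add_one_le
  refine lt_of_le_of_ne (specPrime_mono p h) ?_
  intro he
  have : f ∈ (specPrime p U').asIdeal := h1
  rw [← he] at this
  exact h2 this

lemma height_lower {σ : Type*} {K : Type*} [Field K] {n : ℕ}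
    (D E F G : Fin n → σ) (hD : Function.Injective D) (hE : Function.Injective E)
    (hDE : ∀ i j, D i ≠ E j) (hF : ∀ i j, F i = D j → j < i) (hG : ∀ i j, G i = D j → j < i)
    (p : Ideal (MvPolynomial σ K)) [hp : p.IsPrime]
    (hf : ∀ i, X (D i) * X (E i) - X (F i) * X (G i) ∈ p) :
    (n : ℕ∞) ≤ Order.height (⟨p, hp⟩ : PrimeSpectrum (MvPolynomial σ K)) := by
  classical
  let T : Finset (Fin n) := Finset.univ.filter (fun i => X (E i) ∈ p)
  have h1 : ∀ S : Finset (Fin n), S ⊆ T →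
      (S.card : ℕ∞) ≤ Order.height (specPrime p (E '' (S : Set (Fin n)))) := by
    intro S
    induction S using Finset.induction_on with
    | empty => intro _; simp
    | insert a S ha ih =>
      intro hS
      rw [Finset.card_insert_of_notMem ha]
      push_cast
      have haT : X (E a) ∈ p := by
        have := hS (Finset.mem_insert_self a S)
        simpa [T] using this
      refine le_trans (add_le_add_left (ih (fun x hx => hS (Finset.mem_insert_of_mem hx))) 1) ?_
      apply specPrime_step p (Set.image_mono (by simp)) (X (E a))
      · rw [specHom_X_mem _ (Set.mem_image_of_mem E (by simp)), Ideal.Quotient.eq_zero_iff_mem.mpr haT, map_zero]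
      · rw [specHom_X_not_mem]
        · exact X_ne_zero _
        · rintro ⟨b, hb, hab⟩
          rw [hE hab] at hb
          exact ha hb
  let U : ℕ → Set σ := fun k => {v | ∀ j : Fin n, v = D j → (j : ℕ) < k}
  have h2 : ∀ k ≤ n, ((T.card + (Finset.univ.filter
      (fun i : Fin n => (i : ℕ) < k ∧ i ∉ T)).card : ℕ) : ℕ∞) ≤ Order.height (specPrime p (U k)) := by
    intro k
    induction k with
    | zero =>
      intro _
      have : (Finset.univ.filter (fun i : Fin n => (i : ℕ) < 0 ∧ i ∉ T)) = ∅ := by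
        ext; simp
      rw [this, Finset.card_empty, add_zero]
      refine le_trans (h1 T subset_rfl) (Order.height_mono (specPrime_mono p ?_))
      rintro _ ⟨i, _, rfl⟩ j hj
      exact absurd hj.symm (hDE j i)
    | succ k ih =>
      intro hk
      have ih' := ih (by omega)
      have hUU : U k ⊆ U (k+1) := fun v hv j hj => Nat.lt_succ_of_lt (hv j hj)
      by_cases hT : (⟨k, by omega⟩ : Fin n) ∈ T
      · have : (Finset.univ.filter (fun i : Fin n => (i : ℕ) < k + 1 ∧ i ∉ T)) =
            (Finset.univ.filter (fun i : Fin n => (i : ℕ) < k ∧ i ∉ T)) := by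
          ext i
          simp only [Finset.mem_filter, Finset.mem_univ, true_and]
          constructor
          · rintro ⟨h, h'⟩
            refine ⟨?_, h'⟩
            rcases Nat.lt_succ_iff_lt_or_eq.mp h with h | h
            · exact h
            · exact absurd (by convert hT) h'
          · rintro ⟨h, h'⟩
            exact ⟨by omega, h'⟩
        rw [this]
        exact ih'.trans (Order.height_mono (specPrime_mono p hUU))
      · have : (Finset.univ.filter (fun i : Fin n => (i : ℕ) < k + 1 ∧ i ∉ T)) =
            insert ⟨k, by omega⟩ (Finset.univ.filter (fun i : Fin n => (i : ℕ) < k ∧ i ∉ T)) := by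
          ext i
          simp only [Finset.mem_filter, Finset.mem_univ, true_and, Finset.mem_insert]
          constructor
          · rintro ⟨h, h'⟩
            rcases Nat.lt_succ_iff_lt_or_eq.mp h with h | h
            · exact Or.inr ⟨h, h'⟩
            · exact Or.inl (Fin.ext h)
          · rintro (h | ⟨h, h'⟩)
            · subst h; exact ⟨Nat.lt_succ_self k, hT⟩
            · exact ⟨by omega, h'⟩
        rw [this, Finset.card_insert_of_notMem (by simp), ← add_assoc]
        rw [Nat.cast_add_one]
        refine le_trans (add_le_add_left ih' 1) ?_
        set i : Fin n := ⟨k, by omega⟩ with hi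
        have mE : ∀ l, E i ∈ U l := fun l j hj => absurd hj.symm (hDE j i)
        have mF : F i ∈ U k := fun j hj => hF i j hj
        have mG : G i ∈ U k := fun j hj => hG i j hj
        have mD : D i ∈ U (k+1) := fun j hj => by rw [← hD hj]; exact Nat.lt_succ_self k
        have mD' : D i ∉ U k := fun h => absurd (h i rfl) (by simp [hi])
        apply specPrime_step p hUU (X (D i) * X (E i) - X (F i) * X (G i))
        · simp only [map_sub, map_mul]
          rw [specHom_X_mem _ mD, specHom_X_mem _ (mE _), specHom_X_mem _ (hUU mF),
            specHom_X_mem _ (hUU mG)]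
          simp only [← map_mul, ← map_sub]
          rw [Ideal.Quotient.eq_zero_iff_mem.mpr (hf i), map_zero]
        · simp only [map_sub, map_mul]
          rw [specHom_X_not_mem _ mD', specHom_X_mem _ (mE _), specHom_X_mem _ (mF),
            specHom_X_mem _ (mG)]
          simp only [← map_mul]
          intro h0
          have := congrArg (coeff (Finsupp.single (D i) 1)) h0
          have hne : (0 : σ →₀ ℕ) ≠ Finsupp.single (D i) 1 := fun h =>
            one_ne_zero ((Finsupp.single_eq_zero.mp h.symm))
          rw [coeff_sub, mul_comm, coeff_C_mul, coeff_C, if_neg hne, coeff_zero, sub_zero] at this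
          simp only [coeff_X, if_true, mul_one] at this
          rw [Ideal.Quotient.eq_zero_iff_mem] at this
          exact hT (by simpa [T] using this)
  have h3 := h2 n le_rfl
  have : T.card + (Finset.univ.filter (fun i : Fin n => (i : ℕ) < n ∧ i ∉ T)).card = n := by
    have : (Finset.univ.filter (fun i : Fin n => (i : ℕ) < n ∧ i ∉ T)) = Tᶜ := by
      ext i; simp
    rw [this, Finset.card_add_card_compl, Fintype.card_fin]
  rw [this] at h3
  refine h3.trans ((Order.height_mono (specPrime_mono p (Set.subset_univ _))).trans
    (Order.height_mono (specPrime_univ p)))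

end AbstractAlgebra

section AbstractKoenig
open MvPolynomial

lemma regular_monomials {σ : Type*} {K : Type*} [Field K] {n : ℕ}
    (D E : Fin n → σ) (hD : Function.Injective D) (hE : Function.Injective E)
    (hDE : ∀ i j, D i ≠ E j) (ε : Fin n → K) (hε : ∀ i, ε i ≠ 0) :
    RingTheory.Sequence.IsRegular (MvPolynomial σ K) (List.ofFn (fun i =>
      monomial (Finsupp.single (D i) 1 + Finsupp.single (E i) 1) (ε i))) := by
  classical
  set μ : Fin n → (σ →₀ ℕ) := fun i => Finsupp.single (D i) 1 + Finsupp.single (E i) 1 with hμ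
  have hspan : ∀ k : ℕ, Ideal.ofList ((List.ofFn (fun i => monomial (μ i) (ε i))).take k) =
      Ideal.span ((fun s => monomial s (1 : K)) '' (μ '' {j | (j : ℕ) < k})) := by
    intro k
    have key : ∀ j, monomial (μ j) (ε j) = C (ε j) * monomial (μ j) (1 : K) := by
      intro j; rw [C_mul_monomial, mul_one]
    have key' : ∀ j, monomial (μ j) (1 : K) = C (ε j)⁻¹ * monomial (μ j) (ε j) := by
      intro j; rw [C_mul_monomial, inv_mul_cancel₀ (hε j)]
    apply le_antisymm
    · rw [Ideal.ofList, Ideal.span_le]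
      intro x hx
      obtain ⟨i, hi, rfl⟩ := List.mem_iff_getElem.mp hx
      simp only [List.getElem_take, List.getElem_ofFn]
      rw [key]
      have hi' : i < k ∧ i < n := by simpa using hi
      exact Ideal.mul_mem_left _ _ (Ideal.subset_span ⟨_, ⟨⟨i, hi'.2⟩, hi'.1, rfl⟩, rfl⟩)
    · rw [Ideal.span_le]
      rintro _ ⟨_, ⟨j, hj, rfl⟩, rfl⟩
      simp only
      rw [key']
      refine Ideal.mul_mem_left _ _ (Ideal.subset_span ?_)
      change _ ∈ List.take _ _
      rw [List.mem_iff_getElem]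
      refine ⟨j, ?_, ?_⟩
      · simpa using hj
      · simp
  have hreg : ∀ i : Fin n, ∀ g : MvPolynomial σ K,
      monomial (μ i) (ε i) * g ∈
        Ideal.span ((fun s => monomial s (1 : K)) '' (μ '' {j | (j : ℕ) < i})) →
      g ∈ Ideal.span ((fun s => monomial s (1 : K)) '' (μ '' {j | (j : ℕ) < i})) := by
    intro i g hg
    rw [mem_ideal_span_monomial_image] at hg ⊢
    intro m hm
    obtain ⟨_, ⟨j, hj, rfl⟩, hle⟩ := hg (μ i + m) (by
      rw [mem_support_iff, coeff_monomial_mul]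
      exact mul_ne_zero (hε i) (mem_support_iff.mp hm))
    refine ⟨_, ⟨j, hj, rfl⟩, ?_⟩
    have hij : j ≠ i := by rintro rfl; exact lt_irrefl (j : ℕ) hj
    intro v
    have hv := hle v
    have h1 : D j ≠ D i := fun h => hij (hD h)
    have h2 : E j ≠ E i := fun h => hij (hE h)
    have h3 := hDE j i
    have h4 := hDE i j
    simp only [hμ, Finsupp.add_apply, Finsupp.single_apply] at hv ⊢
    by_cases a : D j = v
    · subst a
      simp only [h1.symm, h3.symm, if_false] at hv
      simpa using hv
    · by_cases b : E j = v
      · subst b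
        simp only [h2.symm, h4, if_false] at hv
        simpa using hv
      · simp [a, b]
  constructor
  · constructor
    intro i hi
    have hi' : i < n := by simpa using hi
    rw [isSMulRegular_quotient_iff_mem_of_smul_mem]
    intro x hx
    simp only [smul_eq_mul, Ideal.mul_top] at hx ⊢
    rw [hspan] at hx ⊢
    apply hreg ⟨i, hi'⟩
    simpa using hx
  · intro h
    simp only [smul_eq_mul, Ideal.mul_top] at h
    have h' := hspan n
    rw [List.take_of_length_le (by simp)] at h'
    rw [h'] at h
    have h1 : (1 : MvPolynomial σ K) ∈ (⊤ : Ideal (MvPolynomial σ K)) := trivial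
    rw [h, mem_ideal_span_monomial_image] at h1
    obtain ⟨_, ⟨j, _, rfl⟩, hle⟩ := h1 0 (by simp)
    have := hle (D j)
    simp [hμ] at this

lemma exists_order {σ : Type u₁} [Finite σ] {n : ℕ}
    (D E F G : Fin n → σ) (hD : Function.Injective D)
    (hDE : ∀ i j, D i ≠ E j) (hF : ∀ i j, F i = D j → j < i) (hG : ∀ i j, G i = D j → j < i) :
    ∃ m : MonomialOrder.{u₁, u₁} σ, ∀ i,
      (Finsupp.single (F i) 1 + Finsupp.single (G i) 1) ≺[m]
        (Finsupp.single (D i) 1 + Finsupp.single (E i) 1) := by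
  classical
  obtain ⟨N, ⟨e⟩⟩ := Finite.exists_equiv_fin σ
  let r : σ → ℕ := fun v => if h : ∃ i, v = D i then n - 1 - (h.choose : ℕ) else n
  have rD : ∀ i, r (D i) = n - 1 - i := by
    intro i
    have h : ∃ j, D i = D j := ⟨i, rfl⟩
    have : h.choose = i := (hD h.choose_spec).symm
    simp only [r]
    rw [dif_pos h, this]
  have rN : ∀ v, (∀ i, v ≠ D i) → r v = n := by
    intro v hv
    simp only [r]
    rw [dif_neg]
    rintro ⟨i, hi⟩
    exact hv i hi
  let key : σ → ℕ ×ₗ Fin N := fun v => toLex (r v, e v)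
  have hkey : Function.Injective key := by
    intro a b h
    have := congrArg (fun z => (ofLex z).2) h
    exact e.injective this
  letI : LinearOrder σ := LinearOrder.lift' key hkey
  have hlt : ∀ a b : σ, r a < r b → a < b := by
    intro a b h
    change key a < key b
    exact Prod.Lex.toLex_lt_toLex.mpr (Or.inl h)
  refine ⟨MonomialOrder.lex, fun i => ?_⟩
  have hdlt : ∀ v, (∀ j, v = D j → j < i) → D i < v := by
    intro v hv
    apply hlt
    rw [rD]
    have hi := i.2
    by_cases h : ∃ j, v = D j
    · obtain ⟨j, rfl⟩ := h
      have := hv j rfl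
      have : (j : ℕ) < i := this
      rw [rD]; omega
    · push Not at h
      rw [rN v h]; omega
  have hDF := hdlt _ (hF i)
  have hDG := hdlt _ (hG i)
  have hDE' := hdlt (E i) (fun j hj => absurd hj.symm (hDE j i))
  rw [MonomialOrder.lex_lt_iff, Finsupp.Lex.lt_iff]
  refine ⟨D i, ?_, ?_⟩
  · intro v hv
    change (Finsupp.single (F i) 1 + Finsupp.single (G i) 1 : σ →₀ ℕ) v =
      (Finsupp.single (D i) 1 + Finsupp.single (E i) 1 : σ →₀ ℕ) v
    simp [Finsupp.single_apply, hv.ne', (hv.trans hDF).ne', (hv.trans hDG).ne',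
      (hv.trans hDE').ne']
  · change (Finsupp.single (F i) 1 + Finsupp.single (G i) 1 : σ →₀ ℕ) (D i) <
      (Finsupp.single (D i) 1 + Finsupp.single (E i) 1 : σ →₀ ℕ) (D i)
    simp [Finsupp.single_apply, hDF.ne', hDG.ne']

lemma XX_eq {σ : Type*} {K : Type*} [Field K] (a b : σ) :
    (X a * X b : MvPolynomial σ K) = monomial (Finsupp.single a 1 + Finsupp.single b 1) 1 := by
  rw [X, X, monomial_mul, mul_one]

lemma abstract_koenig {σ : Type u₁} [Finite σ] {K : Type u₂} [Field K] {n : ℕ}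
    (I : Ideal (MvPolynomial σ K)) (Gs : Set (MvPolynomial σ K))
    (hspan : Ideal.span Gs = I)
    (hhom : ∀ g ∈ Gs, ∃ n, MvPolynomial.IsHomogeneous g n)
    (hmin : ∀ g ∈ Gs, Ideal.span (Gs \ {g}) ≠ I)
    (hupper : ∃ q : PrimeSpectrum (MvPolynomial σ K), I ≤ q.asIdeal ∧ Order.height q ≤ (n : ℕ∞))
    (D E F G : Fin n → σ) (hD : Function.Injective D) (hE : Function.Injective E)
    (hDE : ∀ i j, D i ≠ E j) (hF : ∀ i j, F i = D j → j < i) (hG : ∀ i j, G i = D j → j < i)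
    (hmem : ∀ i, X (D i) * X (E i) - X (F i) * X (G i) ∈ Gs ∨
      X (F i) * X (G i) - X (D i) * X (E i) ∈ Gs) :
    IsKoenigType I := by
  classical
  have hI : ∀ i, X (D i) * X (E i) - X (F i) * X (G i) ∈ I := by
    intro i
    rw [← hspan]
    rcases hmem i with h | h
    · exact Ideal.subset_span h
    · rw [← neg_sub]
      exact neg_mem (Ideal.subset_span h)
  have hex : ∀ i, ∃ ε : K, ε ≠ 0 ∧
      C ε * (X (D i) * X (E i) - X (F i) * X (G i)) ∈ Gs := by
    intro i
    rcases hmem i with h | h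
    · exact ⟨1, one_ne_zero, by simpa using h⟩
    · exact ⟨-1, by simp, by simpa using h⟩
  choose ε hε hεG using hex
  obtain ⟨m, hm⟩ := exists_order D E F G hD hDE hF hG
  have hcoeff : ∀ i, coeff (Finsupp.single (D i) 1 + Finsupp.single (E i) 1)
      (C (ε i) * (X (D i) * X (E i) - X (F i) * X (G i))) = ε i := by
    intro i
    rw [coeff_C_mul, coeff_sub, XX_eq, XX_eq, coeff_monomial, coeff_monomial, if_pos rfl, if_neg]
    · simp
    · intro h
      have := hm i
      rw [h] at this
      exact lt_irrefl _ this
  have hsupp : ∀ i, ∀ d ∈ (C (ε i) * (X (D i) * X (E i) - X (F i) * X (G i))).support,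
      d ≼[m] (Finsupp.single (D i) 1 + Finsupp.single (E i) 1) := by
    intro i d hd
    rw [mem_support_iff, coeff_C_mul, coeff_sub, XX_eq, XX_eq, coeff_monomial, coeff_monomial] at hd
    by_cases h1 : Finsupp.single (D i) 1 + Finsupp.single (E i) 1 = d
    · rw [h1]
    · by_cases h2 : Finsupp.single (F i) 1 + Finsupp.single (G i) 1 = d
      · rw [← h2]; exact (hm i).le
      · simp [h1, h2] at hd
  have hinit : ∀ i, IsInitialTerm m (C (ε i) * (X (D i) * X (E i) - X (F i) * X (G i)))
      (monomial (Finsupp.single (D i) 1 + Finsupp.single (E i) 1) (ε i)) := by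
    intro i
    refine ⟨Finsupp.single (D i) 1 + Finsupp.single (E i) 1, ?_, hsupp i, ?_⟩
    · rw [mem_support_iff, hcoeff]; exact hε i
    · rw [hcoeff]
  refine ⟨n, ?_, fun i => C (ε i) * (X (D i) * X (E i) - X (F i) * X (G i)), Gs, ?_, hεG, hhom,
    hspan, hmin, m, _, hinit, regular_monomials D E hD hE hDE ε hε⟩
  · apply le_antisymm
    · obtain ⟨q, hq, hq'⟩ := hupper
      exact (iInf₂_le q hq).trans hq'
    · refine le_iInf₂ fun p hp => ?_
      haveI := p.isPrime
      exact height_lower D E F G hD hE hDE hF hG p.asIdeal (fun i => hp (hI i))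
  · intro i j hij
    simp only at hij
    have h1 := hsupp i (Finsupp.single (D j) 1 + Finsupp.single (E j) 1) (by
      rw [hij, mem_support_iff, hcoeff]; exact hε j)
    have h2 := hsupp j (Finsupp.single (D i) 1 + Finsupp.single (E i) 1) (by
      rw [← hij, mem_support_iff, hcoeff]; exact hε i)
    have h3 := m.toSyn.injective (le_antisymm h1 h2)
    have h4 := DFunLike.congr_fun h3 (D j)
    by_contra hne
    have hne' : D i ≠ D j := fun h => hne (hD h)
    simp [Finsupp.single_apply, (hDE j i).symm, hne'] at h4

end AbstractKoenig

section PolyAlgebra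
open MvPolynomial

lemma minor_trans {L : Type*} [CommRing L] [IsDomain L] {p q r p' q' r' : L} (hq : q ≠ 0)
    (h1 : p * q' = p' * q) (h2 : q * r' = q' * r) : p * r' = p' * r := by
  apply mul_right_cancel₀ hq
  linear_combination p * h2 + r * h1

lemma minor_grid {L : Type*} [CommRing L] [IsDomain L] (φ : ℤ → ℤ → L) (hφ : ∀ i j, φ i j ≠ 0)
    (x y : ℤ) (k l : ℕ)
    (h : ∀ i j : ℕ, i < k → j < l → φ (x + i) (y + j) * φ (x + i + 1) (y + j + 1) =
      φ (x + i) (y + j + 1) * φ (x + i + 1) (y + j)) :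
    φ x y * φ (x + k) (y + l) = φ x (y + l) * φ (x + k) y := by
  have row : ∀ j : ℕ, j < l → ∀ k' : ℕ, k' ≤ k → φ x (y + j) * φ (x + k') (y + j + 1) =
      φ x (y + j + 1) * φ (x + k') (y + j) := by
    intro j hj k'
    induction k' with
    | zero => intro _; simp [mul_comm]
    | succ k' ih =>
      intro hk
      have := minor_trans (hφ _ _) (ih (by omega)) (h k' j (by omega) hj)
      rw [Nat.cast_add_one, ← add_assoc]
      exact this
  have col : ∀ l' : ℕ, l' ≤ l → φ x y * φ (x + k) (y + l') = φ (x + k) y * φ x (y + l') := by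
    intro l'
    induction l' with
    | zero => intro _; simp [mul_comm]
    | succ l' ih =>
      intro hl
      have := minor_trans (hφ _ _) (ih (by omega)) (row l' (by omega) k le_rfl |>.trans (mul_comm _ _) |> fun e => by
        rw [e, mul_comm])
      rw [Nat.cast_add_one, ← add_assoc]
      exact this
  rw [col l le_rfl, mul_comm]

lemma single_pair_le {σ : Type*} {a b c d : σ} (hab : a ≠ b)
    (h : (Finsupp.single a 1 + Finsupp.single b 1 : σ →₀ ℕ) ≤
      Finsupp.single c 1 + Finsupp.single d 1) : (a = c ∧ b = d) ∨ (a = d ∧ b = c) := by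
  classical
  have h1 := h a
  have h2 := h b
  simp only [Finsupp.add_apply, Finsupp.single_apply] at h1 h2
  by_cases hac : c = a <;> by_cases had : d = a <;> by_cases hbc : c = b <;> by_cases hbd : d = b <;>
    simp_all

lemma innerMinors_hom (K : Type*) [Field K] (P : Finset Cell) :
    ∀ g ∈ innerMinors K P, ∃ n, MvPolynomial.IsHomogeneous g n := by
  rintro g ⟨a, b, c, d, _, _, _, rfl⟩
  exact ⟨2, ((isHomogeneous_X K a).mul (isHomogeneous_X K b)).sub
    ((isHomogeneous_X K c).mul (isHomogeneous_X K d))⟩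

lemma innerMinors_min (K : Type*) [Field K] (P : Finset Cell) :
    ∀ g ∈ innerMinors K P, Ideal.span (innerMinors K P \ {g}) ≠ polyIdeal K P := by
  classical
  rintro g hg heq
  have hgI : g ∈ Ideal.span (innerMinors K P \ {g}) := by
    rw [heq]; exact Ideal.subset_span hg
  obtain ⟨a, b, c, d, hi, hc, hd, hgeq⟩ := hg
  have key : ∀ f ∈ Ideal.span (innerMinors K P \ {g}),
      ∀ m ≤ (Finsupp.single a 1 + Finsupp.single b 1), coeff m f = 0 := by
    intro f hf
    induction hf using Submodule.span_induction with
    | mem f hf =>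
      obtain ⟨⟨a', b', c', d', hi', hc', hd', rfl⟩, hne⟩ := hf
      intro m hm
      rw [coeff_sub, XX_eq, XX_eq, coeff_monomial, coeff_monomial, if_neg, if_neg, sub_zero]
      · rintro rfl
        have hcd : c' ≠ d' := by
          rintro rfl
          rw [hc'] at hd'
          have := congrArg Prod.fst hd'
          exact absurd this hi'.1.ne
        rcases single_pair_le hcd hm with ⟨rfl, rfl⟩ | ⟨rfl, rfl⟩
        · have h1 := hi.2.1
          rw [hc', hd'] at h1
          exact absurd hi'.2.1 (not_lt.mpr h1.le)
        · have h1 := hi.1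
          rw [hc', hd'] at h1
          exact absurd hi'.1 (not_lt.mpr h1.le)
      · rintro rfl
        have hab : a' ≠ b' := by
          rintro rfl
          exact absurd hi'.1 (lt_irrefl _)
        rcases single_pair_le hab hm with ⟨rfl, rfl⟩ | ⟨rfl, rfl⟩
        · apply hne
          have : c' = c := Subtype.ext (hc'.trans hc.symm)
          have h2 : d' = d := Subtype.ext (hd'.trans hd.symm)
          rw [this, h2, Set.mem_singleton_iff, hgeq]
        · exact absurd hi'.1 (not_lt.mpr hi.1.le)
    | zero => intro m _; simp
    | add x y _ _ hx hy => intro m hm; rw [coeff_add, hx m hm, hy m hm, add_zero]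
    | smul r x _ hx =>
      intro m hm
      rw [smul_eq_mul, coeff_mul]
      apply Finset.sum_eq_zero
      intro z hz
      rw [hx z.2 (le_trans (by rw [← Finset.HasAntidiagonal.mem_antidiagonal.mp hz]; exact le_add_self) hm), mul_zero]
  have h0 := key g hgI _ le_rfl
  rw [hgeq, coeff_sub, XX_eq, XX_eq, coeff_monomial, coeff_monomial, if_pos rfl, if_neg] at h0
  · simp at h0
  · intro h
    have hcd : c ≠ d := by
      rintro rfl
      rw [hc] at hd
      exact absurd (congrArg Prod.fst hd) hi.1.ne
    rcases single_pair_le hcd h.le with ⟨rfl, rfl⟩ | ⟨rfl, rfl⟩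
    · have := congrArg Prod.snd hc
      exact absurd this hi.2.1.ne
    · have := congrArg Prod.fst hc
      exact absurd this hi.1.ne'

lemma mem_polyVerts {P : Finset Cell} {c v : Cell} (hc : c ∈ P) (hv : v ∈ cellVerts c) :
    v ∈ polyVerts P := Finset.mem_biUnion.mpr ⟨c, hc, hv⟩

lemma upper_bound (K : Type*) [Field K] (P : Finset Cell) (n : ℕ) (hn : P.card ≤ n) :
    ∃ q : PrimeSpectrum (MvPolynomial {v // v ∈ polyVerts P} K), polyIdeal K P ≤ q.asIdeal ∧
      Order.height q ≤ (n : ℕ∞) := by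
  classical
  let V := {v // v ∈ polyVerts P}
  let Z : Cell → MvPolynomial V K := fun v => if h : v ∈ polyVerts P then X ⟨v, h⟩ else 1
  have hZ : ∀ v : V, Z v = X v := fun v => dif_pos v.2
  let mn : Cell → MvPolynomial V K := fun c =>
    Z c * Z (c.1 + 1, c.2 + 1) - Z (c.1, c.2 + 1) * Z (c.1 + 1, c.2)
  let s : Finset (MvPolynomial V K) := P.image mn
  let ev : MvPolynomial V K →+* K := eval (fun _ => (1 : K))
  have hevZ : ∀ v, ev (Z v) = 1 := by
    intro v
    by_cases h : v ∈ polyVerts P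
    · simp [Z, h, ev]
    · simp [Z, h]
  have hle : Ideal.span (s : Set (MvPolynomial V K)) ≤ RingHom.ker ev := by
    rw [Ideal.span_le]
    intro x hx
    obtain ⟨c, _, rfl⟩ := Finset.mem_image.mp (Finset.mem_coe.mp hx)
    change ev (mn c) = 0
    simp [mn, hevZ]
  have hkp : (RingHom.ker ev).IsPrime := RingHom.ker_isPrime _
  obtain ⟨q, hq, hqle⟩ := Ideal.exists_minimalPrimes_le hle
  have hqp : q.IsPrime := hq.1.1
  have hh := Ideal.height_le_card_of_mem_minimalPrimes_span_finset hq
  refine ⟨⟨q, hqp⟩, ?_, ?_⟩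
  · let φ : ℤ → ℤ → (MvPolynomial V K ⧸ q) := fun i j => Ideal.Quotient.mk q (Z (i, j))
    have hφ : ∀ i j, φ i j ≠ 0 := by
      intro i j h
      have h1 := hqle (Ideal.Quotient.eq_zero_iff_mem.mp h)
      rw [RingHom.mem_ker, hevZ] at h1
      exact one_ne_zero h1
    have hcell : ∀ c ∈ P, φ c.1 c.2 * φ (c.1 + 1) (c.2 + 1) = φ c.1 (c.2 + 1) * φ (c.1 + 1) c.2 := by
      intro c hc
      have h1 : mn c ∈ q := hq.1.2 (Ideal.subset_span (by simpa [s] using ⟨c.1, c.2, hc, rfl⟩))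
      have h2 := Ideal.Quotient.eq_zero_iff_mem.mpr h1
      simp only [mn, map_sub, map_mul] at h2
      exact sub_eq_zero.mp h2
    change Ideal.span _ ≤ q
    rw [Ideal.span_le]
    rintro f ⟨a, b, c, d, hi, hc, hd, rfl⟩
    obtain ⟨k, hk⟩ := Int.eq_ofNat_of_zero_le (sub_nonneg.mpr hi.1.le)
    obtain ⟨l, hl⟩ := Int.eq_ofNat_of_zero_le (sub_nonneg.mpr hi.2.1.le)
    have hb : (b : Cell) = ((a : Cell).1 + k, (a : Cell).2 + l) := by
      ext
      · simp only; omega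
      · simp only; omega
    have hb1 : (b : Cell).1 = (a : Cell).1 + k := congrArg Prod.fst hb
    have hb2 : (b : Cell).2 = (a : Cell).2 + l := congrArg Prod.snd hb
    have hg := minor_grid φ hφ (a : Cell).1 (a : Cell).2 k l (by
      intro i j hik hjl
      exact hcell ((a : Cell).1 + i, (a : Cell).2 + j)
        (hi.2.2 _ (by simp) (by simp only; omega) (by simp) (by simp only; omega)))
    change _ ∈ q
    rw [← Ideal.Quotient.eq_zero_iff_mem, map_sub, map_mul, map_mul, sub_eq_zero,
      ← hZ a, ← hZ b, ← hZ c, ← hZ d, hc, hd, hb]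
    exact hg
  · rw [← PrimeSpectrum.height_eq_orderHeight]
    refine hh.trans ?_
    exact_mod_cast Finset.card_image_le.trans hn

end PolyAlgebra

section LocalGeometry

lemma mem_cellVerts {c v : Cell} : v ∈ cellVerts c ↔
    (v.1 = c.1 ∨ v.1 = c.1 + 1) ∧ (v.2 = c.2 ∨ v.2 = c.2 + 1) := by
  obtain ⟨a, b⟩ := c
  obtain ⟨x, y⟩ := v
  simp only [cellVerts, Finset.mem_insert, Finset.mem_singleton, Prod.mk.injEq]
  omega

/-- The far vertex of `c'` on the line of `y`. -/
def ystep (c c' y : Cell) : Cell :=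
  if c.2 = c'.2 then (if c'.1 = c.1 + 1 then c'.1 + 1 else c'.1, y.2)
  else (y.1, if c'.2 = c.2 + 1 then c'.2 + 1 else c'.2)

/-- The far vertex of `c'` off the line of `y`. -/
def xstep (c c' y : Cell) : Cell :=
  if c.2 = c'.2 then (if c'.1 = c.1 + 1 then c'.1 + 1 else c'.1, 2 * c'.2 + 1 - y.2)
  else (2 * c'.1 + 1 - y.1, if c'.2 = c.2 + 1 then c'.2 + 1 else c'.2)

/-- The fourth corner of the interval spanned by `y` and `xstep c c' y`. -/
def zstep (c c' y : Cell) : Cell :=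
  if c.2 = c'.2 then (y.1, 2 * c'.2 + 1 - y.2) else (2 * c'.1 + 1 - y.1, y.2)

lemma ystep_mem {c c' y : Cell} (h : EdgeAdj c c') (hy : y ∈ cellVerts c) :
    ystep c c' y ∈ cellVerts c' ∧ ystep c c' y ∉ cellVerts c := by
  rw [mem_cellVerts] at hy
  simp only [mem_cellVerts, ystep]
  simp only [EdgeAdj] at h
  split_ifs <;> constructor <;> simp only [true_or, or_true, true_and, and_true] <;> omega

lemma xstep_mem {c c' y : Cell} (h : EdgeAdj c c') (hy : y ∈ cellVerts c) :
    xstep c c' y ∈ cellVerts c' ∧ xstep c c' y ∉ cellVerts c := by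
  rw [mem_cellVerts] at hy
  simp only [mem_cellVerts, xstep]
  simp only [EdgeAdj] at h
  split_ifs <;> constructor <;> simp only [true_or, or_true, true_and, and_true] <;> omega

lemma xstep_ne_ystep (c c' y y' : Cell) (hy : y' = y) : xstep c c' y ≠ ystep c c' y' := by
  subst hy
  simp only [xstep, ystep]
  split_ifs <;> simp only [ne_eq, Prod.mk.injEq] <;> omega

lemma zstep_mem {c c' y : Cell} (h : EdgeAdj c c') (hy : y ∈ cellVerts c) :
    zstep c c' y ∈ cellVerts c := by
  rw [mem_cellVerts] at hy
  simp only [mem_cellVerts, zstep]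
  simp only [EdgeAdj] at h
  split_ifs <;> simp only <;> omega

lemma turn_indep {c c' c'' v w : Cell} (h : EdgeAdj c c') (h' : EdgeAdj c' c'')
    (t1 : c.1 ≠ c''.1) (t2 : c.2 ≠ c''.2)
    (hv : v ∈ cellVerts c') (hv' : v ∉ cellVerts c) (hw : w ∈ cellVerts c')
    (hw' : w ∉ cellVerts c) : ystep c' c'' v = ystep c' c'' w := by
  simp only [mem_cellVerts, EdgeAdj] at *
  simp only [ystep]
  split_ifs <;> simp only [Prod.mk.injEq, true_or, or_true, true_and, and_true] <;> omega

lemma mid_mem {c c' c'' v : Cell} (h : EdgeAdj c c') (h' : EdgeAdj c' c'') (hne : c ≠ c'')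
    (hv : v ∈ cellVerts c) (hv' : v ∈ cellVerts c'') : v ∈ cellVerts c' := by
  have hne' : ¬ (c.1 = c''.1 ∧ c.2 = c''.2) := fun e => hne (Prod.ext e.1 e.2)
  simp only [mem_cellVerts, EdgeAdj] at *
  omega

lemma z_turn {c0 c1 c2 c3 y : Cell} (h1 : EdgeAdj c1 c2)
    (h2 : EdgeAdj c2 c3) (s1 : c0.1 + c2.1 = 2 * c1.1) (s2 : c0.2 + c2.2 = 2 * c1.2)
    (t1 : c1.1 ≠ c3.1) (t2 : c1.2 ≠ c3.2) (hy : y ∈ cellVerts c1) (hy' : y ∉ cellVerts c0) :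
    zstep c2 c3 (ystep c1 c2 y) = y := by
  obtain ⟨a, b⟩ := y
  simp only [mem_cellVerts, EdgeAdj] at *
  simp only [ystep, zstep]
  split_ifs <;> simp only [Prod.mk.injEq, true_or, or_true, true_and, and_true] <;> omega

lemma z_straight {c0 c1 c2 y : Cell} (h0 : EdgeAdj c0 c1)
    (s1 : c0.1 + c2.1 = 2 * c1.1) (s2 : c0.2 + c2.2 = 2 * c1.2) :
    zstep c1 c2 (ystep c0 c1 y) = xstep c0 c1 y := by
  simp only [EdgeAdj] at *
  simp only [ystep, zstep, xstep]
  split_ifs <;> simp only [Prod.mk.injEq, true_or, or_true, true_and, and_true] <;> omega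

lemma straight_disj {c0 c1 c2 v : Cell} (h0 : EdgeAdj c0 c1)
    (s1 : c0.1 + c2.1 = 2 * c1.1) (s2 : c0.2 + c2.2 = 2 * c1.2) (h : v ∈ cellVerts c0)
    (h' : v ∈ cellVerts c2) : False := by
  simp only [mem_cellVerts, EdgeAdj] at *
  omega

lemma not_turn_straight {c c' c'' : Cell} (h : EdgeAdj c c') (h' : EdgeAdj c' c'') (hne : c ≠ c'')
    (ht : ¬ (c.1 ≠ c''.1 ∧ c.2 ≠ c''.2)) : c'' - c' = c' - c := by
  have hne' : ¬ (c.1 = c''.1 ∧ c.2 = c''.2) := fun e => hne (Prod.ext e.1 e.2)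
  simp only [EdgeAdj] at *
  ext
  · simp only [Prod.fst_sub]; omega
  · simp only [Prod.snd_sub]; omega

lemma adj_share {c c' : Cell} (h : EdgeAdj c c') : ∃ v, v ∈ cellVerts c ∧ v ∈ cellVerts c' := by
  refine ⟨(max c.1 c'.1, max c.2 c'.2), ?_⟩
  simp only [mem_cellVerts, EdgeAdj] at *
  omega

lemma adj_symm {c c' : Cell} (h : EdgeAdj c c') : EdgeAdj c' c := by
  simp only [EdgeAdj] at *
  omega

lemma no_triangle {c c' c'' : Cell} (h : EdgeAdj c c') (h' : EdgeAdj c' c'')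
    (h'' : EdgeAdj c c'') : False := by
  simp only [EdgeAdj] at *
  omega

lemma adj_irrefl {c : Cell} (h : EdgeAdj c c) : False := by
  simp only [EdgeAdj] at *
  omega

open MvPolynomial in
lemma step_minor (K : Type*) [Field K] (P : Finset Cell) {c c' : Cell} (hc : c ∈ P) (hc' : c' ∈ P)
    (h : EdgeAdj c c') (D E F G : {v // v ∈ polyVerts P}) (hE : (E : Cell) ∈ cellVerts c)
    (hD : (D : Cell) = xstep c c' E) (hF : (F : Cell) = ystep c c' E)
    (hG : (G : Cell) = zstep c c' E) :
    X D * X E - X F * X G ∈ innerMinors K P ∨ X F * X G - X D * X E ∈ innerMinors K P := by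
  obtain ⟨⟨d1, d2⟩, mD⟩ := D
  obtain ⟨⟨e1, e2⟩, mE⟩ := E
  obtain ⟨⟨f1, f2⟩, mF⟩ := F
  obtain ⟨⟨g1, g2⟩, mG⟩ := G
  obtain ⟨p, q⟩ := c
  obtain ⟨p', q'⟩ := c'
  simp only [mem_cellVerts, EdgeAdj, xstep, ystep, zstep] at *
  have inner : ∀ a b : Cell, a.1 < b.1 → a.2 < b.2 →
      (∀ r : Cell, a.1 ≤ r.1 → r.1 + 1 ≤ b.1 → a.2 ≤ r.2 → r.2 + 1 ≤ b.2 →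
        (r.1 = p ∧ r.2 = q) ∨ (r.1 = p' ∧ r.2 = q')) → IsInnerInterval P a b := by
    intro a b h1 h2 h3
    refine ⟨h1, h2, fun r r1 r2 r3 r4 => ?_⟩
    rcases h3 r r1 r2 r3 r4 with e | e
    · rw [show r = (p, q) from Prod.ext e.1 e.2]; exact hc
    · rw [show r = (p', q') from Prod.ext e.1 e.2]; exact hc'
  have eqs : (d1 = f1 ∧ e1 = g1 ∧ d2 = g2 ∧ e2 = f2) ∨ (d2 = f2 ∧ e2 = g2 ∧ d1 = g1 ∧ e1 = f1) := by
    split_ifs at hD hF hG <;> simp only [Prod.mk.injEq] at hD hF hG <;> omega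
  have bd : d1 ≠ e1 ∧ d2 ≠ e2 ∧ ∀ r1 r2 : ℤ, min d1 e1 ≤ r1 → r1 + 1 ≤ max d1 e1 →
      min d2 e2 ≤ r2 → r2 + 1 ≤ max d2 e2 → (r1 = p ∧ r2 = q) ∨ (r1 = p' ∧ r2 = q') := by
    split_ifs at hD hF hG <;> simp only [Prod.mk.injEq] at hD hF hG <;>
      refine ⟨by omega, by omega, fun r1 r2 _ _ _ _ => by omega⟩
  obtain ⟨n1, n2, hb⟩ := bd
  clear hD hF hG
  rcases lt_or_gt_of_ne n1 with l1 | l1 <;> rcases lt_or_gt_of_ne n2 with l2 | l2 <;>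
    simp only [min_eq_left l1.le, max_eq_right l1.le, min_eq_left l2.le, max_eq_right l2.le,
      min_eq_right l1.le, max_eq_left l1.le, min_eq_right l2.le, max_eq_left l2.le] at hb <;>
    rcases eqs with ⟨rfl, rfl, rfl, rfl⟩ | ⟨rfl, rfl, rfl, rfl⟩
  · exact Or.inl ⟨⟨_, mD⟩, ⟨_, mE⟩, ⟨_, mF⟩, ⟨_, mG⟩,
      inner _ _ l1 l2 (fun r h1 h2 h3 h4 => hb r.1 r.2 h1 h2 h3 h4), rfl, rfl, by ring⟩
  · exact Or.inl ⟨⟨_, mD⟩, ⟨_, mE⟩, ⟨_, mG⟩, ⟨_, mF⟩,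
      inner _ _ l1 l2 (fun r h1 h2 h3 h4 => hb r.1 r.2 h1 h2 h3 h4), rfl, rfl, by ring⟩
  · exact Or.inr ⟨⟨_, mF⟩, ⟨_, mG⟩, ⟨_, mD⟩, ⟨_, mE⟩,
      inner _ _ l1 l2 (fun r h1 h2 h3 h4 => hb r.1 r.2 h1 h2 h3 h4), rfl, rfl, by ring⟩
  · exact Or.inr ⟨⟨_, mG⟩, ⟨_, mF⟩, ⟨_, mD⟩, ⟨_, mE⟩,
      inner _ _ l1 l2 (fun r h1 h2 h3 h4 => hb r.1 r.2 h1 h2 h3 h4), rfl, rfl, by ring⟩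
  · exact Or.inr ⟨⟨_, mG⟩, ⟨_, mF⟩, ⟨_, mE⟩, ⟨_, mD⟩,
      inner _ _ l1 l2 (fun r h1 h2 h3 h4 => hb r.1 r.2 h1 h2 h3 h4), rfl, rfl, by ring⟩
  · exact Or.inr ⟨⟨_, mF⟩, ⟨_, mG⟩, ⟨_, mE⟩, ⟨_, mD⟩,
      inner _ _ l1 l2 (fun r h1 h2 h3 h4 => hb r.1 r.2 h1 h2 h3 h4), rfl, rfl, by ring⟩
  · exact Or.inl ⟨⟨_, mE⟩, ⟨_, mD⟩, ⟨_, mG⟩, ⟨_, mF⟩,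
      inner _ _ l1 l2 (fun r h1 h2 h3 h4 => hb r.1 r.2 h1 h2 h3 h4), rfl, rfl, by ring⟩
  · exact Or.inl ⟨⟨_, mE⟩, ⟨_, mD⟩, ⟨_, mF⟩, ⟨_, mG⟩,
      inner _ _ l1 l2 (fun r h1 h2 h3 h4 => hb r.1 r.2 h1 h2 h3 h4), rfl, rfl, by ring⟩

end LocalGeometry

section Global

variable {n : ℕ} {A : ZMod n → Cell} {P : Finset Cell}

lemma zmod_ne (hn : 5 < n) (k : ℕ) (h0 : 0 < k) (h5 : k ≤ 5) : (k : ZMod n) ≠ 0 := by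
  rw [Ne, ZMod.natCast_eq_zero_iff]
  intro h
  have := Nat.le_of_dvd h0 h
  omega

lemma cp_adj (hA : IsClosedPathSeq n A P) {i j : ZMod n} (h : j = i + 1) :
    EdgeAdj (A i) (A j) := by
  subst h; exact hA.1 i

lemma cp_near (hA : IsClosedPathSeq n A P) {i j : ZMod n} {v : Cell} (hi : v ∈ cellVerts (A i))
    (hj : v ∈ cellVerts (A j)) : j = i - 2 ∨ j = i - 1 ∨ j = i ∨ j = i + 1 ∨ j = i + 2 := by
  by_contra hc
  have := hA.2.2.1 i j (by simpa using hc)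
  have hm := Finset.mem_inter.2 ⟨hi, hj⟩
  rw [this] at hm
  simp at hm

lemma cp_mid (hn : 5 < n) (hA : IsClosedPathSeq n A P) {i j k : ZMod n} {v : Cell}
    (hj : j = i + 1) (hk : k = i + 2) (hi : v ∈ cellVerts (A i))
    (hv : v ∈ cellVerts (A k)) : v ∈ cellVerts (A j) := by
  refine mid_mem (cp_adj hA hj) (cp_adj hA (j := k) (by subst hj hk; ring)) ?_ hi hv
  intro e
  have := hA.2.1 e
  rw [hk] at this
  have h2 : (2 : ZMod n) = 0 := by linear_combination -this
  exact zmod_ne hn 2 (by norm_num) (by norm_num) (by exact_mod_cast h2)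

lemma cp_nbr (hA : IsClosedPathSeq n A P) {i j : ZMod n} (h : EdgeAdj (A i) (A j)) :
    j = i - 1 ∨ j = i + 1 := by
  obtain ⟨v, hv, hv'⟩ := adj_share h
  rcases cp_near hA hv hv' with e | e | e | e | e
  · exact (no_triangle (adj_symm h) (adj_symm (cp_adj hA (i := i - 1) (j := i) (by ring)))
      (cp_adj hA (by rw [e]; ring))).elim
  · exact Or.inl e
  · subst e; exact (adj_irrefl h).elim
  · exact Or.inr e
  · exact (no_triangle (cp_adj hA (i := i) (j := i + 1) rfl)
      (cp_adj hA (j := j) (by rw [e]; ring)) h).elim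

lemma cp_far (hn : 5 < n) (hA : IsClosedPathSeq n A P) {i j : ZMod n} {v : Cell}
    (hi : v ∈ cellVerts (A i)) (hi' : v ∉ cellVerts (A (i - 1)))
    (hj : v ∈ cellVerts (A j)) (hj' : v ∉ cellVerts (A (j - 1))) : i = j := by
  rcases cp_near hA hi hj with e | e | e | e | e
  · exact (hi' (cp_mid hn hA (by rw [e]; ring) (by rw [e]; ring) hj hi)).elim
  · rw [← e] at hi'; exact (hi' hj).elim
  · exact e.symm
  · exact (hj' (by rw [e]; simpa using hi)).elim
  · exact (hj' (cp_mid hn hA (by rw [e]; ring) e hi hj)).elim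

lemma adj_add {c d : Cell} (hd : UnitVec d) : EdgeAdj c (c + d) := by
  rcases hd with rfl | rfl | rfl | rfl <;> simp [EdgeAdj]

lemma cp_turn (hn : 5 < n) (hA : IsClosedPathSeq n A P) : ∃ k, ChangesDirAt A k := by
  by_contra hc
  push Not at hc
  have hs : ∀ k, A (k + 1) - A k = A k - A (k - 1) := by
    intro k
    refine not_turn_straight (cp_adj hA (by ring)) (cp_adj hA rfl) ?_ (hc k)
    intro e
    have := hA.2.1 e
    have h2 : (2 : ZMod n) = 0 := by linear_combination -this
    exact zmod_ne hn 2 (by norm_num) (by norm_num) (by exact_mod_cast h2)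
  have hd : ∀ t : ℕ, A ((t : ZMod n) + 1) - A t = A 1 - A 0 := by
    intro t
    induction t with
    | zero => simp
    | succ t ih =>
      rw [hs]
      push_cast
      simpa using ih
  have hl : ∀ t : ℕ, A t = A 0 + t • (A 1 - A 0) := by
    intro t
    induction t with
    | zero => simp
    | succ t ih =>
      have := hd t
      push_cast
      rw [sub_eq_iff_eq_add.1 this, ih, succ_nsmul]
      abel
  have h := hl n
  rw [ZMod.natCast_self] at h
  have h0 : A 1 - A 0 = 0 := by
    have h' : n • (A 1 - A 0) = 0 := by simpa using h.symm
    rcases smul_eq_zero.1 h' with h | h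
    · omega
    · exact h
  have := cp_adj hA (i := 0) (j := 1) (by ring)
  rw [sub_eq_zero.1 h0] at this
  exact adj_irrefl this

lemma cp_corner (hn : 5 < n) (hA : IsClosedPathSeq n A P)
    (hL : HasLConfigAtEveryChangeOfDir A P) : ∃ m : ZMod n,
    ((A (m - 1)).1 ≠ (A (m + 1)).1 ∧ (A (m - 1)).2 ≠ (A (m + 1)).2) ∧
    ((A (m - 2)).1 + (A m).1 = 2 * (A (m - 1)).1 ∧ (A (m - 2)).2 + (A m).2 = 2 * (A (m - 1)).2) ∧
    ((A m).1 + (A (m + 2)).1 = 2 * (A (m + 1)).1 ∧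
      (A m).2 + (A (m + 2)).2 = 2 * (A (m + 1)).2) := by
  obtain ⟨k, hk⟩ := cp_turn hn hA
  obtain ⟨C, ⟨d, e, hd, he, ho, h1, h2, h3, h4⟩, hP, -⟩ := hL k hk
  have hr : ∀ i, ∃ j, A j = C i := by
    intro i
    have : C i ∈ (P : Set Cell) := hP i
    rw [hA.2.2.2] at this
    exact this
  choose j hj using hr
  have a01 : EdgeAdj (C 0) (C 1) := by rw [h1]; exact adj_add hd
  have a12 : EdgeAdj (C 1) (C 2) := by rw [h2]; exact adj_add hd
  have a23 : EdgeAdj (C 2) (C 3) := by rw [h3]; exact adj_add he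
  have a34 : EdgeAdj (C 3) (C 4) := by rw [h4]; exact adj_add he
  have co : ((C 1).1 ≠ (C 3).1 ∧ (C 1).2 ≠ (C 3).2) ∧
      ((C 0).1 + (C 2).1 = 2 * (C 1).1 ∧ (C 0).2 + (C 2).2 = 2 * (C 1).2) ∧
      ((C 2).1 + (C 4).1 = 2 * (C 3).1 ∧ (C 2).2 + (C 4).2 = 2 * (C 3).2) := by
    rw [h4, h3, h2, h1]
    rcases hd with rfl | rfl | rfl | rfl <;> rcases he with rfl | rfl | rfl | rfl <;>
      simp [Orth] at ho <;> simp only [Prod.fst_add, Prod.snd_add] <;> omega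
  have n13 : j 1 ≠ j 3 := by
    intro e
    have : C 1 = C 3 := by rw [← hj, ← hj, e]
    exact co.1.1 (by rw [this])
  have n02 : j 0 ≠ j 2 := by
    intro e
    have : C 0 = C 2 := by rw [← hj, ← hj, e]
    rw [this] at a01 co
    have e1 : C 1 = C 2 := Prod.ext (by omega) (by omega)
    rw [e1] at a12
    exact adj_irrefl a12
  have n24 : j 2 ≠ j 4 := by
    intro e
    have : C 2 = C 4 := by rw [← hj, ← hj, e]
    rw [← this] at a34 co
    have e1 : C 3 = C 2 := Prod.ext (by omega) (by omega)
    rw [e1] at a23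
    exact adj_irrefl a23
  simp only [← hj] at a01 a12 a23 a34 co
  have b1 := cp_nbr hA (adj_symm a12)
  have b3 := cp_nbr hA a23
  have b0 := cp_nbr hA (adj_symm a01)
  have b4 := cp_nbr hA a34
  have key : (j 1 = j 2 - 1 ∧ j 3 = j 2 + 1 ∧ j 0 = j 2 - 2 ∧ j 4 = j 2 + 2) ∨
      (j 1 = j 2 + 1 ∧ j 3 = j 2 - 1 ∧ j 0 = j 2 + 2 ∧ j 4 = j 2 - 2) := by
    rcases b1 with b1 | b1 <;> rcases b3 with b3 | b3
    · exact (n13 (b1.trans b3.symm)).elim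
    · left
      refine ⟨b1, b3, ?_, ?_⟩
      · rcases b0 with b | b
        · rw [b, b1]; ring
        · exact (n02 (by rw [b, b1]; ring)).elim
      · rcases b4 with b | b
        · exact (n24 (by rw [b, b3]; ring)).elim
        · rw [b, b3]; ring
    · right
      refine ⟨b1, b3, ?_, ?_⟩
      · rcases b0 with b | b
        · exact (n02 (by rw [b, b1]; ring)).elim
        · rw [b, b1]; ring
      · rcases b4 with b | b
        · rw [b, b3]; ring
        · exact (n24 (by rw [b, b3]; ring)).elim
    · exact (n13 (b1.trans b3.symm)).elim
  refine ⟨j 2, ?_⟩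
  rcases key with ⟨k1, k3, k0, k4⟩ | ⟨k1, k3, k0, k4⟩
  · rw [k1, k3, k0, k4] at co
    exact co
  · rw [k1, k3, k0, k4] at co
    refine ⟨⟨co.1.1.symm, co.1.2.symm⟩, ?_, ?_⟩ <;> omega

lemma cp_shift (hA : IsClosedPathSeq n A P) (m : ZMod n) :
    IsClosedPathSeq n (fun i => A (i + m)) P := by
  refine ⟨fun i => cp_adj hA (by ring), fun i j h => by simpa using hA.2.1 h, ?_, ?_⟩
  · intro i j h
    refine hA.2.2.1 _ _ fun h' => h ?_
    simp only [Set.mem_insert_iff, Set.mem_singleton_iff] at h' ⊢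
    rcases h' with e | e | e | e | e
    · left; linear_combination e
    · right; left; linear_combination e
    · right; right; left; linear_combination e
    · right; right; right; left; linear_combination e
    · right; right; right; right; linear_combination e
  · rw [hA.2.2.2]
    ext c
    constructor
    · rintro ⟨i, rfl⟩; exact ⟨i - m, by simp⟩
    · rintro ⟨i, rfl⟩; exact ⟨i + m, rfl⟩

lemma val_pred [NeZero n] (hn : 5 < n) {i : ZMod n} (k : ℕ) (hk : k ≤ 5) (h : k ≤ i.val) :
    (i - k).val = i.val - k := by
  have e : (k : ZMod n).val = k := ZMod.val_natCast_of_lt (by omega)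
  rw [ZMod.val_sub (by rw [e]; exact h), e]

lemma cp_y [NeZero n] (hn : 5 < n) (hA : IsClosedPathSeq n A P)
    (t1 : (A (-1)).1 ≠ (A 1).1) (t2 : (A (-1)).2 ≠ (A 1).2) :
    ∃ y : ZMod n → Cell, (∀ i, y (i + 1) = ystep (A i) (A (i + 1)) (y i)) ∧
      ∀ i, y i ∈ cellVerts (A i) ∧ y i ∉ cellVerts (A (i - 1)) := by
  let Y : ℕ → Cell := fun t => Nat.rec (ystep (A (-1)) (A 0) (A (-1)))
    (fun t v => ystep (A t) (A (t + 1)) v) t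
  have Y0 : Y 0 = ystep (A (-1)) (A 0) (A (-1)) := rfl
  have Ys : ∀ t, Y (t + 1) = ystep (A t) (A (t + 1)) (Y t) := fun t => rfl
  have Ym : ∀ t : ℕ, Y t ∈ cellVerts (A t) ∧ Y t ∉ cellVerts (A ((t : ZMod n) - 1)) := by
    intro t
    induction t with
    | zero =>
      rw [Y0]
      have := ystep_mem (cp_adj hA (i := -1) (j := 0) (by ring))
        (y := A (-1)) (by rw [mem_cellVerts]; simp)
      simpa using this
    | succ t ih =>
      rw [Ys]
      have := ystep_mem (cp_adj hA (i := (t : ZMod n)) (j := t + 1) rfl) ih.1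
      push_cast
      simpa using this
  have hm : ∀ i : ZMod n, Y ((i - 1).val + 1) ∈ cellVerts (A i) ∧
      Y ((i - 1).val + 1) ∉ cellVerts (A (i - 1)) := by
    intro i
    have := Ym ((i - 1).val + 1)
    simpa using this
  refine ⟨fun i => Y ((i - 1).val + 1), fun i => ?_, hm⟩
  simp only [add_sub_cancel_right]
  rw [Ys]
  simp only [ZMod.natCast_val, ZMod.cast_id', id]
  by_cases h : i = 0
  · subst h
    have a := Ym 0
    have b := hm 0
    simp only [Nat.cast_zero, zero_sub] at a b
    simp only [ZMod.val_zero, zero_sub, zero_add]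
    exact turn_indep (cp_adj hA (i := -1) (j := 0) (by ring)) (cp_adj hA (by ring)) t1 t2
      a.1 a.2 b.1 b.2
  · have h1 : 1 ≤ i.val := by
      have := (ZMod.val_eq_zero i).not.2 h
      omega
    have := val_pred hn 1 (by norm_num) h1
    rw [Nat.cast_one] at this
    rw [this, Nat.sub_add_cancel h1]

lemma koenig_of_corner [NeZero n] (K : Type*) [Field K] (hn : 5 < n) (hA : IsClosedPathSeq n A P)
    (t1 : (A (-1)).1 ≠ (A 1).1) (t2 : (A (-1)).2 ≠ (A 1).2)
    (s1 : (A (-2)).1 + (A 0).1 = 2 * (A (-1)).1) (s2 : (A (-2)).2 + (A 0).2 = 2 * (A (-1)).2)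
    (s3 : (A 0).1 + (A 2).1 = 2 * (A 1).1) (s4 : (A 0).2 + (A 2).2 = 2 * (A 1).2) :
    IsKoenigType (polyIdeal K P) := by
  obtain ⟨y, hy, hym⟩ := cp_y hn hA t1 t2
  let x : ZMod n → Cell := fun p => xstep (A p) (A (p + 1)) (y p)
  let z : ZMod n → Cell := fun p => zstep (A p) (A (p + 1)) (y p)
  have hxm : ∀ p, x p ∈ cellVerts (A (p + 1)) ∧ x p ∉ cellVerts (A p) :=
    fun p => xstep_mem (hA.1 p) (hym p).1
  have hzm : ∀ p, z p ∈ cellVerts (A p) := fun p => zstep_mem (hA.1 p) (hym p).1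
  have hAP : ∀ i, A i ∈ P := by
    intro i
    have : A i ∈ (P : Set Cell) := by rw [hA.2.2.2]; exact ⟨i, rfl⟩
    exact this
  have hxi : ∀ p q, x p = x q → p = q := by
    intro p q h
    have := cp_far hn hA (i := p + 1) (j := q + 1) (hxm p).1 (by simpa using (hxm p).2)
      (h ▸ (hxm q).1) (by rw [h]; simpa using (hxm q).2)
    simpa using this
  have hyi : ∀ p q, y p = y q → p = q := fun p q h =>
    cp_far hn hA (hym p).1 (hym p).2 (h ▸ (hym q).1) (by rw [h]; exact (hym q).2)
  have hxy : ∀ p q, x p ≠ y q := by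
    intro p q h
    have := cp_far hn hA (i := p + 1) (j := q) (hxm p).1 (by simpa using (hxm p).2)
      (h ▸ (hym q).1) (by rw [h]; exact (hym q).2)
    rw [← this, hy] at h
    exact xstep_ne_ystep _ _ _ _ rfl h
  have hzx : ∀ p q, z p = x q → q.val < p.val := by
    intro p q h
    have h' : q + 1 = p ∨ q + 1 = p - 1 ∨ q + 1 = p - 2 := by
      rcases cp_near hA (hzm p) (h ▸ (hxm q).1) with e | e | e | e | e
      · exact Or.inr (Or.inr e)
      · exact Or.inr (Or.inl e)
      · exact Or.inl e
      · have e' : q = p := by simpa using e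
        subst e'
        exact ((hxm q).2 (h ▸ hzm q)).elim
      · refine ((hxm q).2 (cp_mid hn hA (i := p) (k := q + 1) ?_ e (h ▸ hzm p) (hxm q).1)).elim
        linear_combination e
    have hc : ((p.val : ℕ) : ZMod n) = p := by simp
    by_cases h3 : 3 ≤ p.val
    · have v1 := val_pred hn 1 (by norm_num) (by omega : 1 ≤ p.val)
      have v2 := val_pred hn 2 (by norm_num) (by omega : 2 ≤ p.val)
      have v3 := val_pred hn 3 (by norm_num) (by omega : 3 ≤ p.val)
      push_cast at v1 v2 v3
      rcases h' with e | e | e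
      · rw [show q = p - 1 by linear_combination e]; omega
      · rw [show q = p - 2 by linear_combination e]; omega
      · rw [show q = p - 3 by linear_combination e]; omega
    have hp : p.val = 0 ∨ p.val = 1 ∨ p.val = 2 := by omega
    rcases hp with hp | hp | hp <;> rw [hp] at hc ⊢ <;> push_cast at hc <;> subst hc
    · exfalso
      have e : z 0 = y (-1) := by
        have := z_turn (cp_adj hA (i := -1) (j := 0) (by ring)) (cp_adj hA (i := 0) (j := 1) (by ring))
          s1 s2 t1 t2 (hym (-1)).1 (by have := (hym (-1)).2; rwa [show (-1 - 1 : ZMod n) = -2 by ring] at this)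
        have y0 := hy (-1)
        rw [show (-1 + 1 : ZMod n) = 0 by ring] at y0
        rw [← y0] at this
        simpa [z] using this
      exact hxy q (-1) (h.symm.trans e)
    · have e : z 1 = x 0 := by
        have := z_straight (y := y 0) (cp_adj hA (i := 0) (j := 1) (by ring)) s3 s4
        have y0 := hy 0
        rw [zero_add] at y0
        rw [← y0] at this
        have e2 : (1 + 1 : ZMod n) = 2 := by norm_num
        simpa only [z, x, e2, zero_add] using this
      have := hxi _ _ (h.symm.trans e)
      subst this
      simp
    · rcases h' with e | e | e
      · rw [show q = ((1 : ℕ) : ZMod n) by push_cast; linear_combination e,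
          ZMod.val_natCast_of_lt (by omega)]
        norm_num
      · rw [show q = 0 by linear_combination e]
        simp
      · exfalso
        have e' : q + 1 = 0 := by linear_combination e
        have hx := (hxm q).1
        rw [e'] at hx
        exact straight_disj (cp_adj hA (i := 0) (j := 1) (by ring)) s3 s4 hx (h ▸ hzm 2)
  have hcard : P.card ≤ n := by
    have : P = Finset.univ.image A := by
      ext c
      have : c ∈ (P : Set Cell) ↔ c ∈ Set.range A := by rw [hA.2.2.2]
      simpa using this
    rw [this]
    exact Finset.card_image_le.trans (by simp)
  have hv : ∀ k : Fin n, ((k : ℕ) : ZMod n).val = k := fun k => ZMod.val_natCast_of_lt k.2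
  have hinj : ∀ i j : Fin n, ((i : ℕ) : ZMod n) = ((j : ℕ) : ZMod n) → i = j := by
    intro i j h
    have := congrArg ZMod.val h
    rw [hv, hv] at this
    exact Fin.ext this
  refine abstract_koenig (n := n) (polyIdeal K P) (innerMinors K P) rfl (innerMinors_hom K P)
    (innerMinors_min K P) (upper_bound K P n hcard)
    (fun k => ⟨x (k : ℕ), mem_polyVerts (hAP _) (hxm _).1⟩)
    (fun k => ⟨y (k : ℕ), mem_polyVerts (hAP _) (hym _).1⟩)
    (fun k => ⟨y ((k : ℕ) + 1), mem_polyVerts (hAP _) (hym _).1⟩)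
    (fun k => ⟨z (k : ℕ), mem_polyVerts (hAP _) (hzm _)⟩) ?_ ?_ ?_ ?_ ?_ ?_
  · intro i j h
    exact hinj _ _ (hxi _ _ (congrArg Subtype.val h))
  · intro i j h
    exact hinj _ _ (hyi _ _ (congrArg Subtype.val h))
  · intro i j h
    exact hxy _ _ (congrArg Subtype.val h)
  · intro i j h
    exact (hxy _ _ (congrArg Subtype.val h).symm).elim
  · intro i j h
    have := hzx _ _ (congrArg Subtype.val h)
    rw [hv, hv] at this
    exact this
  · intro k
    exact step_minor K P (hAP _) (hAP _) (hA.1 (k : ℕ)) _ _ _ _ (hym _).1 rfl (hy _) rfl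

end Global

/-- Let `P` be a closed path polyomino having an L-configuration in every
change of direction. Then `I_P` is of König type. -/
theorem closedPath_koenig_of_LConfig (K : Type*) [Field K] (P : Finset Cell) (n : ℕ)
    (hn : 5 < n) (A : ZMod n → Cell) (hA : IsClosedPathSeq n A P)
    (hL : HasLConfigAtEveryChangeOfDir A P) :
    IsKoenigType (polyIdeal K P) := by
  haveI : NeZero n := ⟨by omega⟩
  obtain ⟨m, ⟨t1, t2⟩, ⟨s1, s2⟩, ⟨s3, s4⟩⟩ := cp_corner hn hA hL
  have e1 : (-1 + m : ZMod n) = m - 1 := by ring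
  have e2 : (-2 + m : ZMod n) = m - 2 := by ring
  have e3 : (1 + m : ZMod n) = m + 1 := by ring
  have e4 : (2 + m : ZMod n) = m + 2 := by ring
  refine koenig_of_corner K hn (cp_shift hA m) ?_ ?_ ?_ ?_ ?_ ?_ <;>
    simp only [e1, e2, e3, e4, zero_add] <;> assumption
end
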